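/- arXiv:1410.7206 — 6 statements merged into one kernel-verified Lean document; each statement's English description precedes it below -/
import Mathlib

section
/- The function V(u) := (μ/2)(κ−ρξu−d(u)) is infinitely differentiable, strictly convex and essentially smooth on the open interval (u_−, u_+) (i.e. V'(u) → −∞ as u ↓ u_− and V'(u) → +∞ as u ↑ u_+); moreover V(0) = 0, and V(1) = 0 if and only if ρ ≤ κ/ξ. -/
open Real Set Filter Asymptotics

noncomputable section

namespace Heston

def dd (κ ξ ρ u : ℝ) : ℝ := Real.sqrt ((κ - ρ*ξ*u)^2 + u*(1-u)*ξ^2)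

def mu (κ θ ξ : ℝ) : ℝ := 2*κ*θ/ξ^2

def VV (κ θ ξ ρ u : ℝ) : ℝ := mu κ θ ξ / 2 * (κ - ρ*ξ*u - dd κ ξ ρ u)

def gam (κ ξ ρ u : ℝ) : ℝ := (κ - ρ*ξ*u - dd κ ξ ρ u) / (κ - ρ*ξ*u + dd κ ξ ρ u)

def bet (κ ξ t : ℝ) : ℝ := ξ^2/(4*κ) * (1 - Real.exp (-(κ*t)))

def HH (κ θ ξ ρ v t u : ℝ) : ℝ :=
  VV κ θ ξ ρ u * v * Real.exp (-(κ*t)) / (κ*θ - 2 * bet κ ξ t * VV κ θ ξ ρ u)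
  - mu κ θ ξ * Real.log ((κ*θ - 2 * bet κ ξ t * VV κ θ ξ ρ u) / (κ*θ*(1 - gam κ ξ ρ u)))

def eta (κ ξ ρ : ℝ) : ℝ := Real.sqrt (ξ^2*(1-ρ^2) + (2*κ - ρ*ξ)^2)

def uplus (κ ξ ρ : ℝ) : ℝ := (ξ - 2*κ*ρ + eta κ ξ ρ) / (2*ξ*(1-ρ^2))

def uminus (κ ξ ρ : ℝ) : ℝ := (ξ - 2*κ*ρ - eta κ ξ ρ) / (2*ξ*(1-ρ^2))

def psi (κ ξ ρ t : ℝ) : ℝ := ξ*(Real.exp (κ*t) - 1) - 4*κ*ρ*Real.exp (κ*t)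

def nuu (κ ξ ρ t : ℝ) : ℝ := Real.sqrt ((psi κ ξ ρ t)^2 - 16*κ^2*Real.exp (κ*t))

def ustarplus (κ ξ ρ t : ℝ) : ℝ := (psi κ ξ ρ t + nuu κ ξ ρ t) / (2*ξ*(Real.exp (κ*t) - 1))

def ustarminus (κ ξ ρ t : ℝ) : ℝ := (psi κ ξ ρ t - nuu κ ξ ρ t) / (2*ξ*(Real.exp (κ*t) - 1))

def rhoplus (κ ξ t : ℝ) : ℝ :=
  Real.exp (-(2*κ*t)) * (ξ*(Real.exp (2*κ*t) - 1)
    + (Real.exp (κ*t) + 1) * Real.sqrt (16*κ^2*Real.exp (2*κ*t) + ξ^2*(1 - Real.exp (κ*t))^2)) / (8*κ)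

def rhominus (κ ξ t : ℝ) : ℝ :=
  Real.exp (-(2*κ*t)) * (ξ*(Real.exp (2*κ*t) - 1)
    - (Real.exp (κ*t) + 1) * Real.sqrt (16*κ^2*Real.exp (2*κ*t) + ξ^2*(1 - Real.exp (κ*t))^2)) / (8*κ)

def R1 (κ ξ ρ t : ℝ) : Prop := rhominus κ ξ t ≤ ρ ∧ ρ ≤ min (rhoplus κ ξ t) (κ/ξ)
def R2 (κ ξ ρ t : ℝ) : Prop := -1 < ρ ∧ ρ < rhominus κ ξ t
def R3a (κ ξ ρ t : ℝ) : Prop := rhoplus κ ξ t < ρ ∧ ρ < 1 ∧ ρ ≤ κ/ξ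
def R3b (κ ξ ρ t : ℝ) : Prop := rhoplus κ ξ t < ρ ∧ ρ < 1 ∧ κ/ξ < ρ
def R4 (κ ξ ρ t : ℝ) : Prop := κ/ξ < ρ ∧ ρ ≤ min (rhoplus κ ξ t) 1

def D1 (κ ξ ρ : ℝ) : Set ℝ := Set.Icc (uminus κ ξ ρ) (uplus κ ξ ρ)
def D2 (κ ξ ρ t : ℝ) : Set ℝ := Set.Ico (uminus κ ξ ρ) (ustarplus κ ξ ρ t)
def D3a (κ ξ ρ t : ℝ) : Set ℝ := Set.Ioc (ustarminus κ ξ ρ t) (uplus κ ξ ρ)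
def D3b (κ ξ ρ t : ℝ) : Set ℝ := Set.Ioc (ustarminus κ ξ ρ t) 1
def D4 (κ ξ ρ : ℝ) : Set ℝ := Set.Ioc (uminus κ ξ ρ) 1

def regimeD (κ ξ ρ t : ℝ) (D : Set ℝ) : Prop :=
  (R1 κ ξ ρ t ∧ D = D1 κ ξ ρ) ∨ (R2 κ ξ ρ t ∧ D = D2 κ ξ ρ t) ∨
  (R3a κ ξ ρ t ∧ D = D3a κ ξ ρ t) ∨ (R3b κ ξ ρ t ∧ D = D3b κ ξ ρ t) ∨
  (R4 κ ξ ρ t ∧ D = D4 κ ξ ρ)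

def Vstar (κ θ ξ ρ : ℝ) (D : Set ℝ) (k : ℝ) : ℝ :=
  sSup ((fun u => u*k - VV κ θ ξ ρ u) '' D)

def ZZ (κ θ ξ ρ k : ℝ) : ℝ :=
  if k < deriv (VV κ θ ξ ρ) 0 then -1
  else if k ≤ deriv (VV κ θ ξ ρ) 1 then 1
  else if κ ≤ ρ*ξ then 1 else -1

def v0inf (κ θ ξ ρ : ℝ) (D : Set ℝ) (k : ℝ) : ℝ :=
  2*(2*Vstar κ θ ξ ρ D k - k
    + 2*ZZ κ θ ξ ρ k * Real.sqrt (Vstar κ θ ξ ρ D k * (Vstar κ θ ξ ρ D k - k)))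

theorem dd_radicand_eq {κ ξ ρ : ℝ} (hξ : 0 < ξ) (hρ₁ : -1 < ρ) (hρ₂ : ρ < 1) (u : ℝ) :
    (κ - ρ*ξ*u)^2 + u*(1-u)*ξ^2 =
      ξ^2*(1-ρ^2) * ((u - uminus κ ξ ρ) * (uplus κ ξ ρ - u)) := by
  have hr : 0 < 1 - ρ^2 := by nlinarith
  have he : eta κ ξ ρ ^ 2 = ξ^2*(1-ρ^2) + (2*κ - ρ*ξ)^2 := Real.sq_sqrt (by positivity)
  have hsum : 2*ξ*(1-ρ^2) * uplus κ ξ ρ = ξ - 2*κ*ρ + eta κ ξ ρ := by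
    unfold uplus; field_simp
  have hdiff : 2*ξ*(1-ρ^2) * uminus κ ξ ρ = ξ - 2*κ*ρ - eta κ ξ ρ := by
    unfold uminus; field_simp
  have h0 : 4*(1-ρ^2) ≠ 0 := by positivity
  apply mul_left_cancel₀ h0
  have key : 4*(1-ρ^2) * (ξ^2*(1-ρ^2) * ((u - uminus κ ξ ρ) * (uplus κ ξ ρ - u))) =
      (2*ξ*(1-ρ^2)*u - 2*ξ*(1-ρ^2) * uminus κ ξ ρ) *
        (2*ξ*(1-ρ^2) * uplus κ ξ ρ - 2*ξ*(1-ρ^2)*u) := by ring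
  rw [key, hsum, hdiff]
  linear_combination (-1 : ℝ) * he

theorem uminus_lt_uplus {κ ξ ρ : ℝ} (hξ : 0 < ξ) (hρ₁ : -1 < ρ) (hρ₂ : ρ < 1) :
    uminus κ ξ ρ < uplus κ ξ ρ := by
  have hr : 0 < 1 - ρ^2 := by nlinarith
  have he : 0 < eta κ ξ ρ := Real.sqrt_pos.2 (by positivity)
  unfold uminus uplus
  gcongr
  linarith

theorem quadratic_pos {A a b u : ℝ} (hA : 0 < A) (hu : u ∈ Ioo a b) :
    0 < A * ((u - a) * (b - u)) :=
  mul_pos hA (mul_pos (sub_pos.2 hu.1) (sub_pos.2 hu.2))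

theorem contDiffOn_sqrt_quadratic {A a b : ℝ} (hA : 0 < A) :
    ContDiffOn ℝ (⊤ : ℕ∞) (fun u => √(A * ((u - a) * (b - u)))) (Ioo a b) :=
  ContDiffOn.sqrt (by fun_prop) fun _ hu => (quadratic_pos hA hu).ne'

theorem strictConcaveOn_sqrt_quadratic {A a b : ℝ} (hA : 0 < A) :
    StrictConcaveOn ℝ (Ioo a b) (fun u => √(A * ((u - a) * (b - u)))) := by
  refine ⟨convex_Ioo a b, fun x hx y hy hxy s t hs ht hst => ?_⟩
  have hqx := quadratic_pos hA hx
  have hqy := quadratic_pos hA hy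
  have hsqrt := Real.strictConcaveOn_sqrt.concaveOn.2 (mem_Ici.2 hqx.le) (mem_Ici.2 hqy.le)
    hs.le ht.le hst
  refine hsqrt.trans_lt (Real.sqrt_lt_sqrt ?_ ?_)
  · simp only [smul_eq_mul]; positivity
  · have hd : 0 < A * (s * t * (x - y)^2) := by
      have := sub_ne_zero.2 hxy
      positivity
    obtain rfl : t = 1 - s := by linarith
    simp only [smul_eq_mul]
    nlinarith

theorem hasDerivAt_sqrt_quadratic {A a b u : ℝ} (hA : 0 < A) (hu : u ∈ Ioo a b) :
    HasDerivAt (fun u => √(A * ((u - a) * (b - u))))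
      (A * (a + b - 2*u) / (2 * √(A * ((u - a) * (b - u))))) u := by
  have hq : HasDerivAt (fun u => A * ((u - a) * (b - u))) (A * (a + b - 2*u)) u := by
    refine ((((hasDerivAt_id' u).sub_const a).mul
      ((hasDerivAt_id' u).const_sub b)).const_mul A).congr_deriv ?_
    ring
  exact hq.sqrt (quadratic_pos hA hu).ne'

theorem tendsto_inv_sqrt_quadratic {A a b c : ℝ} {l : Filter ℝ} (hA : 0 < A) (hl : l ≤ nhds c)
    (hab : ∀ᶠ u in l, u ∈ Ioo a b) (hc : (c - a) * (b - c) = 0) :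
    Tendsto (fun u => (2 * √(A * ((u - a) * (b - u))))⁻¹) l atTop := by
  refine Tendsto.inv_tendsto_nhdsGT_zero (tendsto_nhdsWithin_iff.2 ⟨?_, ?_⟩)
  · have hcont : Continuous fun u => 2 * √(A * ((u - a) * (b - u))) := by fun_prop
    have := (hcont.tendsto c).mono_left hl
    simpa only [hc, mul_zero, Real.sqrt_zero] using this
  · filter_upwards [hab] with u hu
    exact mul_pos two_pos (Real.sqrt_pos.2 (quadratic_pos hA hu))

theorem tendsto_deriv_sqrt_quadratic_left {A a b : ℝ} (hA : 0 < A) (hab : a < b) :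
    Tendsto (fun u => A * (a + b - 2*u) / (2 * √(A * ((u - a) * (b - u)))))
      (nhdsWithin a (Ioi a)) atTop := by
  have hinv := tendsto_inv_sqrt_quadratic (c := a) hA nhdsWithin_le_nhds
    (Ioo_mem_nhdsGT hab) (by ring)
  have hcont : Continuous fun u => A * (a + b - 2*u) := by fun_prop
  exact ((hcont.tendsto a).mono_left nhdsWithin_le_nhds).pos_mul_atTop
    (mul_pos hA (by linarith)) hinv

theorem tendsto_deriv_sqrt_quadratic_right {A a b : ℝ} (hA : 0 < A) (hab : a < b) :
    Tendsto (fun u => A * (a + b - 2*u) / (2 * √(A * ((u - a) * (b - u)))))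
      (nhdsWithin b (Iio b)) atBot := by
  have hinv := tendsto_inv_sqrt_quadratic (c := b) hA nhdsWithin_le_nhds
    (Ioo_mem_nhdsLT hab) (by ring)
  have hcont : Continuous fun u => A * (a + b - 2*u) := by fun_prop
  exact ((hcont.tendsto b).mono_left nhdsWithin_le_nhds).neg_mul_atTop
    (mul_neg_of_pos_of_neg hA (by linarith)) hinv

theorem stmt0 (κ θ ξ ρ : ℝ) (hκ : 0 < κ) (hθ : 0 < θ) (hξ : 0 < ξ)
    (hρ₁ : -1 < ρ) (hρ₂ : ρ < 1) :
    ContDiffOn ℝ (⊤ : ℕ∞) (VV κ θ ξ ρ) (Set.Ioo (uminus κ ξ ρ) (uplus κ ξ ρ)) ∧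
    StrictConvexOn ℝ (Set.Ioo (uminus κ ξ ρ) (uplus κ ξ ρ)) (VV κ θ ξ ρ) ∧
    Tendsto (deriv (VV κ θ ξ ρ)) (nhdsWithin (uminus κ ξ ρ) (Set.Ioi (uminus κ ξ ρ))) atBot ∧
    Tendsto (deriv (VV κ θ ξ ρ)) (nhdsWithin (uplus κ ξ ρ) (Set.Iio (uplus κ ξ ρ))) atTop ∧
    VV κ θ ξ ρ 0 = 0 ∧ (VV κ θ ξ ρ 1 = 0 ↔ ρ ≤ κ/ξ) := by
  have hA : 0 < ξ^2*(1-ρ^2) := mul_pos (by positivity) (by nlinarith)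
  have hab := uminus_lt_uplus (κ := κ) hξ hρ₁ hρ₂
  have hc : 0 < mu κ θ ξ / 2 := by unfold mu; positivity
  have hV : VV κ θ ξ ρ = fun u => mu κ θ ξ / 2 * (κ - ρ*ξ*u -
      √(ξ^2*(1-ρ^2) * ((u - uminus κ ξ ρ) * (uplus κ ξ ρ - u)))) := by
    funext u
    rw [VV, dd, dd_radicand_eq hξ hρ₁ hρ₂]
  have hV0 : VV κ θ ξ ρ 0 = 0 := by simp [VV, dd, Real.sqrt_sq hκ.le]
  have hV1 : VV κ θ ξ ρ 1 = 0 ↔ ρ ≤ κ/ξ := by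
    have h1 : VV κ θ ξ ρ 1 = mu κ θ ξ / 2 * (κ - ρ*ξ - |κ - ρ*ξ|) := by
      simp [VV, dd, Real.sqrt_sq_eq_abs]
    rw [h1, mul_eq_zero, or_iff_right hc.ne', sub_eq_zero, eq_comm, abs_eq_self, sub_nonneg,
      le_div_iff₀ hξ]
  refine ⟨?_, ?_, ?_, ?_, hV0, hV1⟩
  all_goals
    rw [hV]
    clear hV hV0 hV1
    generalize ξ^2*(1-ρ^2) = A at hA ⊢
    generalize uminus κ ξ ρ = a at hab ⊢
    generalize uplus κ ξ ρ = b at hab ⊢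
    generalize mu κ θ ξ / 2 = c at hc ⊢
  · have := contDiffOn_sqrt_quadratic (a := a) (b := b) hA
    fun_prop
  · refine ⟨convex_Ioo a b, fun x hx y hy hxy s t hs ht hst => ?_⟩
    have h := (strictConcaveOn_sqrt_quadratic hA).2 hx hy hxy hs ht hst
    have h' := mul_lt_mul_of_pos_left h hc
    simp only [smul_eq_mul] at h' ⊢
    obtain rfl : t = 1 - s := by linarith
    linarith
  all_goals
    have hderiv : ∀ u ∈ Ioo a b, deriv (fun u => c * (κ - ρ*ξ*u - √(A * ((u - a) * (b - u))))) u =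
        c * (-(ρ*ξ) + -(A * (a + b - 2*u) / (2 * √(A * ((u - a) * (b - u)))))) := by
      intro u hu
      refine (((((hasDerivAt_id' u).const_mul (ρ*ξ)).const_sub κ).sub
        (hasDerivAt_sqrt_quadratic hA hu)).const_mul c).deriv.trans ?_
      ring
  · have hlim := (tendsto_atBot_add_const_left _ (-(ρ*ξ)) (tendsto_neg_atTop_atBot.comp
      (tendsto_deriv_sqrt_quadratic_left hA hab))).const_mul_atBot hc
    refine hlim.congr' ?_
    filter_upwards [Ioo_mem_nhdsGT hab] with u hu using (hderiv u hu).symm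
  · have hlim := (tendsto_atTop_add_const_left _ (-(ρ*ξ)) (tendsto_neg_atBot_atTop.comp
      (tendsto_deriv_sqrt_quadratic_right hA hab))).const_mul_atTop hc
    refine hlim.congr' ?_
    filter_upwards [Ioo_mem_nhdsLT hab] with u hu using (hderiv u hu).symm

end Heston
end
end

section
/- For any forward-start date t > 0: (i) ρ_− ∈ (−1,0) and ρ_+ > 1/2; (ii) for every ρ ∈ [−1, ρ_−] ∪ [ρ_+, 1] one has ψ² ≥ 16κ²e^{κt}, so that ν := sqrt(ψ² − 16κ²e^{κt}) is a well-defined real number; (iii) if ρ ∈ (−1, ρ_−) then 1 < u*_+ < u_+, and if ρ ∈ (ρ_+, 1) then u_− < u*_− < 0; (iv) when t = 0 the formulas give ρ_+ = 1 and ρ_− = −1. -/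
open Real Set Filter Asymptotics

noncomputable section

namespace Heston

/-- The quadratic in `ρ` (with `a = e^{κt}`) whose roots are `rhominus` and `rhoplus`. -/
def rhoQuad (κ ξ ρ a : ℝ) : ℝ := 4*κ*a^2*ρ^2 - ξ*(a^2-1)*ρ - κ*(a+1)^2

theorem exp_two_mul_mul (κ t : ℝ) : exp (2*κ*t) = exp (κ*t)^2 := by
  rw [sq, ← exp_add]; ring_nf

theorem rhoQuad_eq_mul {κ : ℝ} (hκ : 0 < κ) (ξ ρ t : ℝ) :
    rhoQuad κ ξ ρ (exp (κ*t)) =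
      4*κ*exp (κ*t)^2 * ((ρ - rhominus κ ξ t) * (ρ - rhoplus κ ξ t)) := by
  have ha := exp_pos (κ*t)
  unfold rhominus rhoplus rhoQuad
  rw [exp_neg, exp_two_mul_mul]
  set a := exp (κ*t)
  have hS : √(16*κ^2*a^2 + ξ^2*(1-a)^2)^2 = 16*κ^2*a^2 + ξ^2*(1-a)^2 := sq_sqrt (by positivity)
  set S := √(16*κ^2*a^2 + ξ^2*(1-a)^2)
  field_simp
  linear_combination 4*(a+1)^2 * hS

theorem rhominus_le_rhoplus {κ : ℝ} (hκ : 0 < κ) (ξ t : ℝ) :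
    rhominus κ ξ t ≤ rhoplus κ ξ t := by
  unfold rhominus rhoplus
  gcongr
  rw [sub_eq_add_neg]
  gcongr
  have : 0 ≤ (exp (κ*t) + 1) * √(16*κ^2*exp (2*κ*t) + ξ^2*(1 - exp (κ*t))^2) := by positivity
  linarith

theorem rhominus_lt_and_lt_rhoplus_of_rhoQuad_neg {κ ξ ρ t : ℝ} (hκ : 0 < κ)
    (h : rhoQuad κ ξ ρ (exp (κ*t)) < 0) : rhominus κ ξ t < ρ ∧ ρ < rhoplus κ ξ t := by
  have hle := rhominus_le_rhoplus hκ ξ t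
  rw [rhoQuad_eq_mul hκ] at h
  have h' := neg_of_mul_neg_right h (by positivity)
  constructor <;> by_contra! hc <;> nlinarith

theorem rhominus_neg_and_rhoplus_gt {κ ξ t : ℝ} (hκ : 0 < κ) (hξ : 0 < ξ) (ht : 0 < t) :
    -1 < rhominus κ ξ t ∧ rhominus κ ξ t < 0 ∧ 1/2 < rhoplus κ ξ t := by
  have ha : 1 < exp (κ*t) := one_lt_exp_iff.2 (by positivity)
  have hle := rhominus_le_rhoplus hκ ξ t
  have hx : 0 < ξ*(exp (κ*t)^2-1) := mul_pos hξ (by nlinarith)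
  have h0 : rhominus κ ξ t < 0 ∧ 0 < rhoplus κ ξ t := by
    apply rhominus_lt_and_lt_rhoplus_of_rhoQuad_neg hκ
    unfold rhoQuad
    have : 0 < κ*(exp (κ*t)+1)^2 := by positivity
    linarith
  refine ⟨?_, h0.1, (rhominus_lt_and_lt_rhoplus_of_rhoQuad_neg hκ ?_).2⟩
  · have h1 : 0 < rhoQuad κ ξ (-1) (exp (κ*t)) := by
      unfold rhoQuad
      have : 0 < κ*((exp (κ*t)-1)*(3*exp (κ*t)+1)) :=
        mul_pos hκ (mul_pos (by linarith) (by linarith))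
      linarith
    rw [rhoQuad_eq_mul hκ] at h1
    have h2 := (pos_iff_pos_of_mul_pos h1).1 (by positivity)
    by_contra! hc
    nlinarith
  · unfold rhoQuad
    have : 0 < κ*(2*exp (κ*t)+1) := by positivity
    linarith

theorem rhoQuad_add_psi (κ ξ ρ t : ℝ) :
    rhoQuad κ ξ ρ (exp (κ*t)) + ρ*(exp (κ*t)+1)*psi κ ξ ρ t =
      -(κ*(exp (κ*t)+1)^2 + 4*κ*exp (κ*t)*ρ^2) := by
  unfold rhoQuad psi; ring

theorem le_psi_sq_of_rhoQuad_nonneg {κ ξ ρ t : ℝ} (hκ : 0 < κ) (hρ : ρ ≠ 0)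
    (h : 0 ≤ rhoQuad κ ξ ρ (exp (κ*t))) : 16*κ^2*exp (κ*t) ≤ psi κ ξ ρ t^2 := by
  have ha := exp_pos (κ*t)
  have key := rhoQuad_add_psi κ ξ ρ t
  set a := exp (κ*t)
  set p := psi κ ξ ρ t
  have hB : 0 < κ*(a+1)^2 + 4*κ*a*ρ^2 := by positivity
  have h1 : (κ*(a+1)^2 + 4*κ*a*ρ^2)^2 ≤ (-(ρ*(a+1)*p))^2 :=
    pow_le_pow_left₀ hB.le (by linarith) 2
  have h2 : 0 < (ρ*(a+1))^2 := by positivity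
  refine le_of_mul_le_mul_left ?_ h2
  linarith [sq_nonneg (κ*(a+1)^2 - 4*κ*a*ρ^2)]

theorem uminus_lt_and_lt_uplus {κ ξ ρ u : ℝ} (hξ : 0 < ξ) (hρ : 0 < 1 - ρ^2)
    (h : 0 < (κ - ρ*ξ*u)^2 + u*(1-u)*ξ^2) : uminus κ ξ ρ < u ∧ u < uplus κ ξ ρ := by
  have hη : eta κ ξ ρ^2 = ξ^2*(1-ρ^2) + (2*κ-ρ*ξ)^2 := sq_sqrt (by positivity)
  have hη0 : 0 ≤ eta κ ξ ρ := sqrt_nonneg _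
  have h1 : (2*ξ*(1-ρ^2)*u - (ξ-2*κ*ρ))^2 < eta κ ξ ρ^2 := by
    rw [hη]
    linarith [mul_pos hρ h]
  obtain ⟨h2, h3⟩ := abs_lt.1 (abs_lt_of_sq_lt_sq h1 hη0)
  unfold uminus uplus
  rw [div_lt_iff₀ (by positivity), lt_div_iff₀ (by positivity)]
  constructor <;> linarith

/-- A root of the quadratic defining `ustarminus` and `ustarplus` lies strictly between
`uminus` and `uplus`. -/
theorem uminus_lt_and_lt_uplus_of_root {κ ξ ρ t w : ℝ} (hκ : 0 < κ) (hξ : 0 < ξ) (ht : 0 < t)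
    (hρ : 0 < 1 - ρ^2) (hq : 0 < rhoQuad κ ξ ρ (exp (κ*t)))
    (hw : w^2 - psi κ ξ ρ t*w + 4*κ^2*exp (κ*t) = 0) :
    uminus κ ξ ρ < w/(ξ*(exp (κ*t)-1)) ∧ w/(ξ*(exp (κ*t)-1)) < uplus κ ξ ρ := by
  have ha : 0 < exp (κ*t) - 1 := sub_pos.2 (one_lt_exp_iff.2 (by positivity))
  have key := rhoQuad_add_psi κ ξ ρ t
  have hpsi : psi κ ξ ρ t = ξ*(exp (κ*t)-1) - 4*κ*ρ*exp (κ*t) := rfl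
  apply uminus_lt_and_lt_uplus hξ hρ
  set a := exp (κ*t)
  set p := psi κ ξ ρ t
  have hne : ρ*w + κ*(a+1) ≠ 0 := by
    intro h0
    have : κ * rhoQuad κ ξ ρ a = 0 := by
      linear_combination κ*key - ρ^2*hw + (ρ*w - κ*(a+1) - ρ*p)*h0
    exact (mul_pos hκ hq).ne' this
  have heq : (κ - ρ*ξ*(w/(ξ*(a-1))))^2 + w/(ξ*(a-1))*(1-w/(ξ*(a-1)))*ξ^2 =
      ((ρ*w + κ*(a+1))/(a-1))^2 := by
    have := ha.ne'
    field_simp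
    linear_combination -hw - w*hpsi
  rw [heq]
  have := ha.ne'
  positivity

theorem nuu_sq {κ ξ ρ t : ℝ} (h : 16*κ^2*exp (κ*t) ≤ psi κ ξ ρ t^2) :
    nuu κ ξ ρ t^2 = psi κ ξ ρ t^2 - 16*κ^2*exp (κ*t) :=
  sq_sqrt (sub_nonneg.2 h)

theorem ustarplus_eq (κ ξ ρ t : ℝ) :
    ustarplus κ ξ ρ t = (psi κ ξ ρ t + nuu κ ξ ρ t)/2/(ξ*(exp (κ*t)-1)) := by
  unfold ustarplus; rw [div_div]; ring_nf

theorem ustarminus_eq (κ ξ ρ t : ℝ) :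
    ustarminus κ ξ ρ t = (psi κ ξ ρ t - nuu κ ξ ρ t)/2/(ξ*(exp (κ*t)-1)) := by
  unfold ustarminus; rw [div_div]; ring_nf

theorem one_lt_ustarplus {κ ξ ρ t : ℝ} (hκ : 0 < κ) (hξ : 0 < ξ) (ht : 0 < t) (hρ : ρ < 0)
    (hq : 0 < rhoQuad κ ξ ρ (exp (κ*t))) : 1 < ustarplus κ ξ ρ t := by
  have ha : 1 < exp (κ*t) := one_lt_exp_iff.2 (by positivity)
  have hν := nuu_sq (le_psi_sq_of_rhoQuad_nonneg hκ hρ.ne hq.le)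
  have hν0 : 0 ≤ nuu κ ξ ρ t := sqrt_nonneg _
  have hden : 0 < 2*ξ*(exp (κ*t)-1) := mul_pos (by positivity) (by linarith)
  unfold ustarplus
  rw [lt_div_iff₀ hden]
  unfold rhoQuad at hq
  unfold psi at hν ⊢
  set a := exp (κ*t)
  set n := nuu κ ξ ρ t
  by_contra! hc
  have h1 : n ≤ ξ*(a-1) + 4*κ*ρ*a := by linarith
  have h2 : n^2 ≤ (ξ*(a-1) + 4*κ*ρ*a)^2 := pow_le_pow_left₀ hν0 h1 2
  have h3 : -ρ*(ξ*(a-1)) ≤ κ := by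
    have h16 : 0 < 16*κ*a := by positivity
    refine le_of_mul_le_mul_left ?_ h16
    linarith
  have h4 : 0 ≤ -ρ*(ξ*(a-1) + 4*κ*ρ*a) := mul_nonneg (by linarith) (by linarith)
  have h5 : -ρ*(ξ*(a-1))*(a+1) ≤ κ*(a+1) := by gcongr
  have h6 : 4*κ*a*ρ^2*a ≤ κ*a := mul_le_mul_of_nonneg_right (by linarith) (by linarith)
  have h7 : 0 < κ*(a*a) := by positivity
  linarith

theorem ustarminus_neg {κ ξ ρ t : ℝ} (hκ : 0 < κ) (hξ : 0 < ξ) (ht : 0 < t) (hρ : 0 < ρ)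
    (hq : 0 < rhoQuad κ ξ ρ (exp (κ*t))) : ustarminus κ ξ ρ t < 0 := by
  have ha : 1 < exp (κ*t) := one_lt_exp_iff.2 (by positivity)
  have key := rhoQuad_add_psi κ ξ ρ t
  have hν0 : 0 ≤ nuu κ ξ ρ t := sqrt_nonneg _
  have hB : 0 < κ*(exp (κ*t)+1)^2 + 4*κ*exp (κ*t)*ρ^2 := by positivity
  have hψ : psi κ ξ ρ t < 0 := by
    refine neg_of_mul_neg_right (a := ρ*(exp (κ*t)+1)) (by linarith) (by positivity)
  exact div_neg_of_neg_of_pos (by linarith) (mul_pos (by positivity) (by linarith))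

theorem stmt2 (κ θ ξ t : ℝ) (hκ : 0 < κ) (hθ : 0 < θ) (hξ : 0 < ξ) (ht : 0 < t) :
    (-1 < rhominus κ ξ t ∧ rhominus κ ξ t < 0 ∧ 1/2 < rhoplus κ ξ t) ∧
    (∀ ρ : ℝ, ρ ∈ Set.Icc (-1 : ℝ) (rhominus κ ξ t) ∪ Set.Icc (rhoplus κ ξ t) 1 →
      16*κ^2*Real.exp (κ*t) ≤ (psi κ ξ ρ t)^2) ∧
    (∀ ρ : ℝ, -1 < ρ → ρ < rhominus κ ξ t →
      1 < ustarplus κ ξ ρ t ∧ ustarplus κ ξ ρ t < uplus κ ξ ρ) ∧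
    (∀ ρ : ℝ, rhoplus κ ξ t < ρ → ρ < 1 →
      uminus κ ξ ρ < ustarminus κ ξ ρ t ∧ ustarminus κ ξ ρ t < 0) ∧
    (rhoplus κ ξ 0 = 1 ∧ rhominus κ ξ 0 = -1) := by
  have hρ := rhominus_neg_and_rhoplus_gt hκ hξ ht
  have hle := rhominus_le_rhoplus hκ ξ t
  refine ⟨hρ, ?_, ?_, ?_, ?_⟩
  · rintro ρ (⟨-, h⟩ | ⟨h, -⟩)
    · refine le_psi_sq_of_rhoQuad_nonneg hκ (by linarith) ?_
      rw [rhoQuad_eq_mul hκ]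
      exact mul_nonneg (by positivity) (mul_nonneg_of_nonpos_of_nonpos (by linarith) (by linarith))
    · refine le_psi_sq_of_rhoQuad_nonneg hκ (by linarith) ?_
      rw [rhoQuad_eq_mul hκ]
      exact mul_nonneg (by positivity) (mul_nonneg (by linarith) (by linarith))
  · intro ρ h1 h2
    have hq : 0 < rhoQuad κ ξ ρ (exp (κ*t)) := by
      rw [rhoQuad_eq_mul hκ]
      exact mul_pos (by positivity) (mul_pos_of_neg_of_neg (by linarith) (by linarith))
    refine ⟨one_lt_ustarplus hκ hξ ht (by linarith) hq, ?_⟩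
    have hν := nuu_sq (le_psi_sq_of_rhoQuad_nonneg hκ (by linarith) hq.le)
    rw [ustarplus_eq]
    exact (uminus_lt_and_lt_uplus_of_root hκ hξ ht (by nlinarith) hq
      (by linear_combination hν/4)).2
  · intro ρ h1 h2
    have hq : 0 < rhoQuad κ ξ ρ (exp (κ*t)) := by
      rw [rhoQuad_eq_mul hκ]
      exact mul_pos (by positivity) (mul_pos (by linarith) (by linarith))
    refine ⟨?_, ustarminus_neg hκ hξ ht (by linarith) hq⟩
    have hν := nuu_sq (le_psi_sq_of_rhoQuad_nonneg hκ (by linarith) hq.le)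
    rw [ustarminus_eq]
    exact (uminus_lt_and_lt_uplus_of_root hκ hξ ht (by nlinarith) hq
      (by linear_combination hν/4)).1
  · have hS : √(16*κ^2) = 4*κ := by
      rw [show 16*κ^2 = (4*κ)^2 by ring]
      exact sqrt_sq (by positivity)
    constructor
    · simp only [rhoplus, mul_zero, neg_zero, exp_zero, sub_self, mul_one, ne_eq,
        OfNat.ofNat_ne_zero, not_false_eq_true, zero_pow, add_zero, hS]
      field_simp
      ring
    · simp only [rhominus, mul_zero, neg_zero, exp_zero, sub_self, mul_one, ne_eq,
        OfNat.ofNat_ne_zero, not_false_eq_true, zero_pow, add_zero, hS]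
      field_simp
      ring

end Heston
end
end

section
/- For every k ∈ ℝ the quantity k²ξ² + 2kκθρξ + κ²θ² is strictly positive, the point u*(k) := (ξ−2κρ + (κθρ+kξ)·η·(k²ξ²+2kκθρξ+κ²θ²)^{−1/2})/(2ξ(1−ρ²)) lies in the open interval (u_−, u_+), and u*(k) is the unique solution in (u_−, u_+) of the saddlepoint equation V'(u) = k. -/
open Real Set Filter Asymptotics

noncomputable section

namespace Heston

def ustar (κ θ ξ ρ k : ℝ) : ℝ :=
  (ξ - 2*κ*ρ + (κ*θ*ρ + k*ξ) * eta κ ξ ρ / Real.sqrt (k^2*ξ^2 + 2*k*κ*θ*ρ*ξ + κ^2*θ^2))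
    / (2*ξ*(1-ρ^2))

lemma eta_pos {κ ξ ρ : ℝ} (hξ : 0 < ξ) (hP : 0 < 1 - ρ^2) : 0 < eta κ ξ ρ :=
  Real.sqrt_pos.2 (by positivity)

lemma eta_sq {κ ξ ρ : ℝ} (hP : 0 < 1 - ρ^2) :
    eta κ ξ ρ ^ 2 = (ξ - 2*κ*ρ)^2 + 4*κ^2*(1-ρ^2) := by
  rw [eta, Real.sq_sqrt (by positivity)]
  ring

/-- The centred variable `2ξ(1-ρ²)u - (ξ - 2κρ)` maps `(u₋, u₊)` onto `(-η, η)`. -/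
lemma mem_Ioo_iff {κ ξ ρ u : ℝ} (hξ : 0 < ξ) (hP : 0 < 1 - ρ^2) :
    u ∈ Set.Ioo (uminus κ ξ ρ) (uplus κ ξ ρ) ↔
      -eta κ ξ ρ < 2*ξ*(1-ρ^2)*u - (ξ - 2*κ*ρ) ∧
        2*ξ*(1-ρ^2)*u - (ξ - 2*κ*ρ) < eta κ ξ ρ := by
  have hc : 0 < 2*ξ*(1-ρ^2) := by positivity
  rw [Set.mem_Ioo, uminus, uplus, div_lt_iff₀ hc, lt_div_iff₀ hc]
  constructor <;> rintro ⟨h₁, h₂⟩ <;> constructor <;> linarith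

lemma four_mul_radicand {κ ξ ρ : ℝ} (hP : 0 < 1 - ρ^2) (u : ℝ) :
    4*(1-ρ^2)*((κ - ρ*ξ*u)^2 + u*(1-u)*ξ^2) =
      eta κ ξ ρ ^ 2 - (2*ξ*(1-ρ^2)*u - (ξ - 2*κ*ρ))^2 := by
  rw [eta_sq hP]
  ring

lemma radicand_pos {κ ξ ρ u : ℝ} (hξ : 0 < ξ) (hP : 0 < 1 - ρ^2)
    (hu : u ∈ Set.Ioo (uminus κ ξ ρ) (uplus κ ξ ρ)) :
    0 < (κ - ρ*ξ*u)^2 + u*(1-u)*ξ^2 := by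
  obtain ⟨h₁, h₂⟩ := (mem_Ioo_iff hξ hP).1 hu
  have h := four_mul_radicand (κ := κ) (ξ := ξ) hP u
  have hpos : 0 < 4*(1-ρ^2)*((κ - ρ*ξ*u)^2 + u*(1-u)*ξ^2) := by
    rw [h]
    nlinarith
  exact pos_of_mul_pos_right hpos (by positivity)

lemma hasDerivAt_VV {κ θ ξ ρ u : ℝ} (hξ : 0 < ξ) (hP : 0 < 1 - ρ^2)
    (hu : u ∈ Set.Ioo (uminus κ ξ ρ) (uplus κ ξ ρ)) :
    HasDerivAt (VV κ θ ξ ρ)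
      (κ*θ/ξ * ((2*ξ*(1-ρ^2)*u - (ξ - 2*κ*ρ)) / (2 * dd κ ξ ρ u) - ρ)) u := by
  have hR := radicand_pos hξ hP hu
  have hd : 0 < dd κ ξ ρ u := Real.sqrt_pos.2 hR
  have hlin : HasDerivAt (fun x : ℝ => κ - ρ*ξ*x) (-(ρ*ξ)) u := by
    simpa using ((hasDerivAt_id u).const_mul (ρ*ξ)).const_sub κ
  have hrad : HasDerivAt (fun x : ℝ => (κ - ρ*ξ*x)^2 + x*(1-x)*ξ^2)
      (-ξ*(2*ξ*(1-ρ^2)*u - (ξ - 2*κ*ρ))) u := by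
    refine ((hlin.pow 2).add (((hasDerivAt_id u).mul
      ((hasDerivAt_id u).const_sub 1)).mul_const (ξ^2))).congr_deriv ?_
    simp only [id]
    push_cast
    ring
  refine ((hlin.sub (hrad.sqrt hR.ne')).const_mul (mu κ θ ξ / 2)).congr_deriv ?_
  change mu κ θ ξ / 2 * (-(ρ*ξ) - _ / (2 * dd κ ξ ρ u)) = _
  rw [mu]
  field_simp
  ring

lemma deriv_VV_eq_iff {κ θ ξ ρ u k : ℝ} (hκ : 0 < κ) (hθ : 0 < θ) (hξ : 0 < ξ)
    (hP : 0 < 1 - ρ^2) (hu : u ∈ Set.Ioo (uminus κ ξ ρ) (uplus κ ξ ρ)) :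
    deriv (VV κ θ ξ ρ) u = k ↔
      κ*θ*(2*ξ*(1-ρ^2)*u - (ξ - 2*κ*ρ)) = 2 * dd κ ξ ρ u * (κ*θ*ρ + k*ξ) := by
  have hd : 0 < dd κ ξ ρ u := Real.sqrt_pos.2 (radicand_pos hξ hP hu)
  rw [(hasDerivAt_VV hξ hP hu).deriv]
  generalize 2*ξ*(1-ρ^2)*u - (ξ - 2*κ*ρ) = y
  generalize dd κ ξ ρ u = d at hd
  have h : κ*θ/ξ * (y / (2*d) - ρ) = (κ*θ*y - 2*d*(κ*θ*ρ)) / (2*d*ξ) := by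
    field_simp
  rw [h, div_eq_iff (by positivity)]
  constructor <;> intro h <;> linarith

theorem stmt3 (κ θ ξ ρ : ℝ) (hκ : 0 < κ) (hθ : 0 < θ) (hξ : 0 < ξ)
    (hρ₁ : -1 < ρ) (hρ₂ : ρ < 1) : ∀ k : ℝ,
    0 < k^2*ξ^2 + 2*k*κ*θ*ρ*ξ + κ^2*θ^2 ∧
    ustar κ θ ξ ρ k ∈ Set.Ioo (uminus κ ξ ρ) (uplus κ ξ ρ) ∧
    deriv (VV κ θ ξ ρ) (ustar κ θ ξ ρ k) = k ∧
    (∀ u ∈ Set.Ioo (uminus κ ξ ρ) (uplus κ ξ ρ),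
      deriv (VV κ θ ξ ρ) u = k → u = ustar κ θ ξ ρ k) := by
  intro k
  have hP : 0 < 1 - ρ^2 := by nlinarith
  have hm : 0 < κ*θ := mul_pos hκ hθ
  have hη := eta_pos (κ := κ) hξ hP
  have hSeq : k^2*ξ^2 + 2*k*κ*θ*ρ*ξ + κ^2*θ^2 = (κ*θ*ρ + k*ξ)^2 + (κ*θ)^2*(1-ρ^2) := by
    ring
  have hS : 0 < k^2*ξ^2 + 2*k*κ*θ*ρ*ξ + κ^2*θ^2 := by
    rw [hSeq]
    positivity
  set s := Real.sqrt (k^2*ξ^2 + 2*k*κ*θ*ρ*ξ + κ^2*θ^2) with hs_def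
  have hs : 0 < s := Real.sqrt_pos.2 hS
  have hs2 : s^2 = (κ*θ*ρ + k*ξ)^2 + (κ*θ)^2*(1-ρ^2) := by
    rw [hs_def, Real.sq_sqrt hS.le, hSeq]
  have hy : 2*ξ*(1-ρ^2)*ustar κ θ ξ ρ k - (ξ - 2*κ*ρ) = (κ*θ*ρ + k*ξ) * eta κ ξ ρ / s := by
    rw [ustar, ← hs_def, mul_div_cancel₀ _ (by positivity)]
    ring
  have hws : |κ*θ*ρ + k*ξ| < s := by
    refine abs_lt_of_sq_lt_sq ?_ hs.le
    nlinarith [mul_pos (pow_pos hm 2) hP]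
  have hmem : ustar κ θ ξ ρ k ∈ Set.Ioo (uminus κ ξ ρ) (uplus κ ξ ρ) := by
    obtain ⟨h₁, h₂⟩ := abs_lt.1 hws
    rw [mem_Ioo_iff hξ hP, hy, lt_div_iff₀ hs, div_lt_iff₀ hs]
    constructor <;> nlinarith
  refine ⟨hS, hmem, ?_, fun u hu hk => ?_⟩
  · rw [deriv_VV_eq_iff hκ hθ hξ hP hmem, hy]
    have hd : dd κ ξ ρ (ustar κ θ ξ ρ k) = eta κ ξ ρ * (κ*θ) / (2*s) := by
      rw [dd, Real.sqrt_eq_iff_eq_sq (radicand_pos hξ hP hmem).le (by positivity)]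
      have h := four_mul_radicand (κ := κ) (ξ := ξ) hP (ustar κ θ ξ ρ k)
      rw [hy] at h
      apply mul_left_cancel₀ (show 4*(1-ρ^2) ≠ 0 by positivity)
      rw [h, div_pow, div_pow, mul_pow 2 s]
      have hs2' : s^2 ≠ 0 := by positivity
      field_simp
      rw [hs2]
      ring
    rw [hd]
    field_simp
  · rw [deriv_VV_eq_iff hκ hθ hξ hP hu] at hk
    have hR := radicand_pos hξ hP hu
    have hd : 0 < dd κ ξ ρ u := Real.sqrt_pos.2 hR
    have h := four_mul_radicand (κ := κ) (ξ := ξ) hP u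
    rw [← Real.sq_sqrt hR.le, ← dd] at h
    have hds : 2 * dd κ ξ ρ u * s = eta κ ξ ρ * (κ*θ) := by
      rw [← sq_eq_sq₀ (by positivity) (by positivity), mul_pow _ s, hs2]
      linear_combination (κ*θ)^2 * h -
        (κ*θ*(2*ξ*(1-ρ^2)*u - (ξ - 2*κ*ρ)) + 2 * dd κ ξ ρ u * (κ*θ*ρ + k*ξ)) * hk
    have hyu : 2*ξ*(1-ρ^2)*u - (ξ - 2*κ*ρ) = (κ*θ*ρ + k*ξ) * eta κ ξ ρ / s := by
      rw [eq_div_iff hs.ne']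
      apply mul_left_cancel₀ hm.ne'
      linear_combination s * hk + (κ*θ*ρ + k*ξ) * hds
    apply mul_left_cancel₀ (show 2*ξ*(1-ρ^2) ≠ 0 by positivity)
    linarith

end Heston
end
end

section
/- Fix u in the interior of D∞ with u ≠ 1. Then d(u) > 0 and there exist constants C > 0 and τ₀ > 0 such that for all τ > τ₀, |Λ_τ(u) − V(u) − H(u)/τ| ≤ C·e^{−d(u)τ}/τ; that is, Λ_τ(u) = V(u) + τ^{−1}H(u)(1 + O(e^{−d(u)τ})) as τ → ∞. -/
open Real Set Filter Asymptotics

noncomputable section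

namespace Heston

def AA (κ θ ξ ρ : ℝ) (u τ : ℝ) : ℝ :=
  mu κ θ ξ / 2 * ((κ - ρ*ξ*u - dd κ ξ ρ u)*τ
    - 2*Real.log ((1 - gam κ ξ ρ u * Real.exp (-(dd κ ξ ρ u * τ)))/(1 - gam κ ξ ρ u)))

def BB (κ ξ ρ : ℝ) (u τ : ℝ) : ℝ :=
  (κ - ρ*ξ*u - dd κ ξ ρ u)/ξ^2 * (1 - Real.exp (-(dd κ ξ ρ u * τ)))
    / (1 - gam κ ξ ρ u * Real.exp (-(dd κ ξ ρ u * τ)))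

def Lam (κ θ ξ ρ v t : ℝ) (τ u : ℝ) : ℝ :=
  (AA κ θ ξ ρ u τ + BB κ ξ ρ u τ * v * Real.exp (-(κ*t)) / (1 - 2*bet κ ξ t*BB κ ξ ρ u τ)
    - mu κ θ ξ * Real.log (1 - 2*bet κ ξ t*BB κ ξ ρ u τ)) / τ

/-- The radicand of `dd`. -/
def radicand (κ ξ ρ u : ℝ) : ℝ := (κ - ρ*ξ*u)^2 + u*(1-u)*ξ^2

/-- The value of `κ - ρ*ξ*u - dd κ ξ ρ u` at which `1 - 2 * bet κ ξ t * BB` vanishes for `τ → ∞`. -/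
def critLevel (κ t : ℝ) : ℝ := 2*κ*Real.exp (κ*t) / (Real.exp (κ*t) - 1)

lemma radicand_eq_factored {κ ξ ρ : ℝ} (hξ : 0 < ξ) (h1 : -1 < ρ) (h2 : ρ < 1) (u : ℝ) :
    radicand κ ξ ρ u = ξ^2*(1-ρ^2)*((u - uminus κ ξ ρ)*(uplus κ ξ ρ - u)) := by
  have hr : 0 < 1 - ρ^2 := by nlinarith
  have he : (eta κ ξ ρ)^2 = ξ^2*(1-ρ^2) + (2*κ - ρ*ξ)^2 :=
    Real.sq_sqrt (by positivity)
  have hm : uminus κ ξ ρ * (2*ξ*(1-ρ^2)) = ξ - 2*κ*ρ - eta κ ξ ρ := by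
    unfold uminus; field_simp
  have hp : uplus κ ξ ρ * (2*ξ*(1-ρ^2)) = ξ - 2*κ*ρ + eta κ ξ ρ := by
    unfold uplus; field_simp
  have key : 4*(1-ρ^2) * radicand κ ξ ρ u
      = (2*ξ*(1-ρ^2)*u - uminus κ ξ ρ * (2*ξ*(1-ρ^2)))
        * (uplus κ ξ ρ * (2*ξ*(1-ρ^2)) - 2*ξ*(1-ρ^2)*u) := by
    rw [hm, hp]; unfold radicand; linear_combination -he
  have h4 : (4*(1-ρ^2)) ≠ 0 := by positivity
  apply mul_left_cancel₀ h4
  rw [key]; ring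

lemma radicand_pos_iff {κ ξ ρ : ℝ} (hξ : 0 < ξ) (h1 : -1 < ρ) (h2 : ρ < 1) (u : ℝ) :
    0 < radicand κ ξ ρ u ↔ uminus κ ξ ρ < u ∧ u < uplus κ ξ ρ := by
  have hr : 0 < 1 - ρ^2 := by nlinarith
  have hle : uminus κ ξ ρ ≤ uplus κ ξ ρ := by
    have : 0 ≤ eta κ ξ ρ := Real.sqrt_nonneg _
    unfold uminus uplus
    gcongr
    linarith
  rw [radicand_eq_factored hξ h1 h2, mul_pos_iff_of_pos_left (by positivity)]
  constructor
  · intro h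
    rcases mul_pos_iff.1 h with h | h <;> constructor <;> linarith [h.1, h.2]
  · rintro ⟨h, h'⟩
    exact mul_pos (by linarith) (by linarith)

lemma lt_uplus_of_lt_one {κ ξ ρ u : ℝ} (hξ : 0 < ξ) (h1 : -1 < ρ) (h2 : ρ < 1)
    (hu : uminus κ ξ ρ < u) (hu1 : u < 1) : u < uplus κ ξ ρ := by
  have hr : 0 < 1 - ρ^2 := by nlinarith
  by_contra! h
  have hf := radicand_eq_factored (κ := κ) hξ h1 h2 1
  have h0 : 0 ≤ radicand κ ξ ρ 1 := by unfold radicand; nlinarith [sq_nonneg (κ - ρ*ξ*1)]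
  have : 0 < (1 - uminus κ ξ ρ) * (1 - uplus κ ξ ρ) := mul_pos (by linarith) (by linarith)
  have : 0 < ξ^2*(1-ρ^2) * ((1 - uminus κ ξ ρ) * (1 - uplus κ ξ ρ)) := by positivity
  linarith

lemma exp_mul_sub_one_pos {κ t : ℝ} (hκ : 0 < κ) (ht : 0 < t) : 0 < Real.exp (κ*t) - 1 := by
  have := Real.one_lt_exp_iff.2 (mul_pos hκ ht)
  linarith

/-- The difference `radicand - (κ - ρ*ξ*u - critLevel)^2` is a quadratic with roots `u*_±`. -/
lemma radicand_sub_sq_eq {κ ξ ρ t : ℝ} (hκ : 0 < κ) (ht : 0 < t) (u : ℝ) :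
    (2*(Real.exp (κ*t) - 1))^2 * (radicand κ ξ ρ u - (κ - ρ*ξ*u - critLevel κ t)^2)
      = ((psi κ ξ ρ t)^2 - 16*κ^2*Real.exp (κ*t))
        - (2*ξ*(Real.exp (κ*t) - 1)*u - psi κ ξ ρ t)^2 := by
  have hE := exp_mul_sub_one_pos hκ ht
  unfold radicand critLevel psi
  field_simp
  ring

lemma radicand_sub_sq_pos_iff {κ ξ ρ t c : ℝ} (hκ : 0 < κ) (hξ : 0 < ξ)
    (ht : 0 < t)
    (hc : 0 < radicand κ ξ ρ c - (κ - ρ*ξ*c - critLevel κ t)^2) (u : ℝ) :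
    0 < radicand κ ξ ρ u - (κ - ρ*ξ*u - critLevel κ t)^2
      ↔ ustarminus κ ξ ρ t < u ∧ u < ustarplus κ ξ ρ t := by
  have hE := exp_mul_sub_one_pos hκ ht
  have h4 : 0 < (2*(Real.exp (κ*t) - 1))^2 := by positivity
  have hdisc : 0 < (psi κ ξ ρ t)^2 - 16*κ^2*Real.exp (κ*t) := by
    have h := mul_pos h4 hc
    rw [radicand_sub_sq_eq hκ ht] at h
    nlinarith [sq_nonneg (2*ξ*(Real.exp (κ*t) - 1)*c - psi κ ξ ρ t)]
  have hK : 0 < 2*ξ*(Real.exp (κ*t) - 1) := by positivity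
  rw [← mul_pos_iff_of_pos_left h4, radicand_sub_sq_eq hκ ht, sub_pos, Real.sq_lt,
    ustarminus, ustarplus, div_lt_iff₀ hK, lt_div_iff₀ hK, nuu]
  constructor <;> rintro ⟨h, h'⟩ <;> constructor <;> linarith

/-- The quadratic in `ρ` with roots `ρ_±`. -/
lemma rho_quadratic_eq {κ ξ t : ℝ} (hκ : 0 < κ) (ht : 0 < t) (ρ : ℝ) :
    (critLevel κ t)^2*ρ^2 - (critLevel κ t - κ)*ξ*ρ - (critLevel κ t - κ)^2
      = (critLevel κ t)^2*((ρ - rhominus κ ξ t)*(ρ - rhoplus κ ξ t)) := by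
  have hE := exp_mul_sub_one_pos hκ ht
  have e2 : Real.exp (2*κ*t) = Real.exp (κ*t)^2 := by rw [← Real.exp_nat_mul]; congr 1; push_cast; ring
  have hE0 := Real.exp_pos (κ*t)
  unfold rhominus rhoplus critLevel
  rw [Real.exp_neg, e2]
  have hs := Real.sq_sqrt (show 0 ≤ 16*κ^2*Real.exp (κ*t)^2 + ξ^2*(1 - Real.exp (κ*t))^2 by positivity)
  set s := Real.sqrt (16*κ^2*Real.exp (κ*t)^2 + ξ^2*(1 - Real.exp (κ*t))^2)
  set E := Real.exp (κ*t)
  field_simp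
  linear_combination 4 * (E+1)^2 * hs

lemma rhominus_neg_and_rhoplus_pos {κ ξ t : ℝ} (hκ : 0 < κ) (hξ : 0 < ξ) (ht : 0 < t) :
    rhominus κ ξ t < 0 ∧ 0 < rhoplus κ ξ t := by
  have hE := exp_mul_sub_one_pos hκ ht
  have e2 : Real.exp (2*κ*t) = Real.exp (κ*t)^2 := by rw [← Real.exp_nat_mul]; congr 1; push_cast; ring
  have hE0 := Real.exp_pos (κ*t)
  unfold rhominus rhoplus
  rw [e2]
  have hs : ξ*(Real.exp (κ*t) - 1)
      < Real.sqrt (16*κ^2*Real.exp (κ*t)^2 + ξ^2*(1 - Real.exp (κ*t))^2) := by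
    apply Real.lt_sqrt_of_sq_lt
    have : 0 < 16*κ^2*Real.exp (κ*t)^2 := by positivity
    nlinarith
  have h0 := Real.exp_pos (-(2*κ*t))
  set s := Real.sqrt (16*κ^2*Real.exp (κ*t)^2 + ξ^2*(1 - Real.exp (κ*t))^2)
  have hp : 0 < ξ*(Real.exp (κ*t) - 1) := by positivity
  have hm := mul_lt_mul_of_pos_left hs (show 0 < Real.exp (κ*t) + 1 by linarith)
  constructor
  · apply div_neg_of_neg_of_pos _ (by positivity)
    apply mul_neg_of_pos_of_neg h0
    linarith
  · apply div_pos _ (by positivity)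
    apply mul_pos h0
    nlinarith

lemma lt_critLevel {κ t : ℝ} (hκ : 0 < κ) (ht : 0 < t) : κ < critLevel κ t := by
  have hE := exp_mul_sub_one_pos hκ ht
  rw [critLevel, lt_div_iff₀ hE]
  nlinarith

/-- The point at which `κ - ρ*ξ*u` reaches the critical level. -/
def critPoint (κ ξ ρ t : ℝ) : ℝ := (κ - critLevel κ t) / (ρ*ξ)

lemma mul_critPoint {κ ξ ρ t : ℝ} (hξ : 0 < ξ) (hρ : ρ ≠ 0) :
    κ - ρ*ξ*critPoint κ ξ ρ t = critLevel κ t := by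
  unfold critPoint
  field_simp
  ring

lemma sq_mul_radicand_critPoint {κ ξ ρ t : ℝ} (hκ : 0 < κ) (hξ : 0 < ξ) (ht : 0 < t) (hρ : ρ ≠ 0) :
    ρ^2 * radicand κ ξ ρ (critPoint κ ξ ρ t)
      = (critLevel κ t)^2*((ρ - rhominus κ ξ t)*(ρ - rhoplus κ ξ t)) := by
  rw [← rho_quadratic_eq hκ ht, radicand, mul_critPoint hξ hρ]
  unfold critPoint
  field_simp
  ring

/-- If `κ - ρ*ξ*u` exceeds the critical level then the critical point lies between `0` and `u`. -/
lemma critPoint_eq_mul {κ ξ ρ t u : ℝ} (hκ : 0 < κ) (hξ : 0 < ξ) (ht : 0 < t)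
    (hu : critLevel κ t < κ - ρ*ξ*u) :
    ρ*u < 0 ∧ ∃ s, 0 < s ∧ s < 1 ∧ critPoint κ ξ ρ t = s*u := by
  have hm := lt_critLevel hκ ht
  have hlt : ξ*(ρ*u) < 0 := by linarith
  have hru : ρ*u < 0 := by
    by_contra! h
    linarith [mul_nonneg hξ.le h]
  have hρ : ρ ≠ 0 := by rintro rfl; simp at hru
  have hu0 : u ≠ 0 := by rintro rfl; simp at hru
  refine ⟨hru, (critLevel κ t - κ) / (-(ξ*(ρ*u))), div_pos (by linarith) (by linarith), ?_, ?_⟩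
  · rw [div_lt_one (by linarith)]; linarith
  · unfold critPoint
    field_simp
    ring

lemma radicand_mul_pos {κ ξ ρ u s : ℝ} (hκ : 0 < κ) (h1 : -1 < ρ) (h2 : ρ < 1)
    (hs0 : 0 < s) (hs1 : s < 1) (hu : 0 < radicand κ ξ ρ u) : 0 < radicand κ ξ ρ (s*u) := by
  have hr : 0 < 1 - ρ^2 := by nlinarith
  have hs : 0 < 1 - s := by linarith
  have : radicand κ ξ ρ (s*u) = (1-s)*κ^2 + s*radicand κ ξ ρ u + ξ^2*(1-ρ^2)*(s*(1-s))*u^2 := by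
    unfold radicand; ring
  rw [this]; positivity

/-- On the interior of the limiting domain the radicand is positive and the limiting level is not
critical. -/
lemma radicand_pos_and_ne_critLevel {κ ξ ρ t u : ℝ} {D : Set ℝ} (hκ : 0 < κ) (hξ : 0 < ξ)
    (h1 : -1 < ρ) (h2 : ρ < 1) (ht : 0 < t) (hD : regimeD κ ξ ρ t D) (hu : u ∈ interior D) :
    0 < radicand κ ξ ρ u ∧ κ - ρ*ξ*u - dd κ ξ ρ u ≠ critLevel κ t := by
  obtain ⟨hρm, hρp⟩ := rhominus_neg_and_rhoplus_pos hκ hξ ht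
  have hm := lt_critLevel hκ ht
  have hm0 : 0 < critLevel κ t := hκ.trans hm
  have level (hf : 0 < radicand κ ξ ρ u) (h : κ - ρ*ξ*u - dd κ ξ ρ u = critLevel κ t) :
      critLevel κ t < κ - ρ*ξ*u ∧
        radicand κ ξ ρ u - (κ - ρ*ξ*u - critLevel κ t)^2 = 0 := by
    have hd : 0 < dd κ ξ ρ u := Real.sqrt_pos.2 hf
    have hd2 : dd κ ξ ρ u ^ 2 = radicand κ ξ ρ u := Real.sq_sqrt hf.le
    refine ⟨by linarith, ?_⟩
    rw [← hd2, ← h]; ring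
  have inner (hf : 0 < radicand κ ξ ρ u) (ha : rhominus κ ξ t ≤ ρ) (hb : ρ ≤ rhoplus κ ξ t) :
      κ - ρ*ξ*u - dd κ ξ ρ u ≠ critLevel κ t := by
    intro h
    obtain ⟨hru, s, hs0, hs1, hs⟩ := critPoint_eq_mul hκ hξ ht (level hf h).1
    have hρ : ρ ≠ 0 := by rintro rfl; simp at hru
    have hc := sq_mul_radicand_critPoint hκ hξ ht hρ
    rw [hs] at hc
    have := radicand_mul_pos hκ h1 h2 hs0 hs1 hf
    have h3 : 0 < ρ^2 * radicand κ ξ ρ (s*u) := by positivity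
    have h4 : (critLevel κ t)^2*((ρ - rhominus κ ξ t)*(ρ - rhoplus κ ξ t)) ≤ 0 :=
      mul_nonpos_of_nonneg_of_nonpos (by positivity)
        (mul_nonpos_of_nonneg_of_nonpos (by linarith) (by linarith))
    linarith
  have outer (hρ : ρ ≠ 0) (hP : 0 < (ρ - rhominus κ ξ t)*(ρ - rhoplus κ ξ t)) :
      0 < radicand κ ξ ρ (critPoint κ ξ ρ t) ∧
      0 < radicand κ ξ ρ (critPoint κ ξ ρ t)
        - (κ - ρ*ξ*critPoint κ ξ ρ t - critLevel κ t)^2 := by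
    have hc := sq_mul_radicand_critPoint hκ hξ ht hρ
    have : 0 < radicand κ ξ ρ (critPoint κ ξ ρ t) := by
      have h3 : 0 < ρ^2 * radicand κ ξ ρ (critPoint κ ξ ρ t) := by rw [hc]; positivity
      exact (mul_pos_iff_of_pos_left (by positivity)).1 h3
    refine ⟨this, ?_⟩
    rw [mul_critPoint hξ hρ]; simpa using this
  have upper (hρ : rhoplus κ ξ t < ρ) (hu1 : ustarminus κ ξ ρ t < u)
      (hu2 : uminus κ ξ ρ < u → u < uplus κ ξ ρ) :
      0 < radicand κ ξ ρ u ∧ κ - ρ*ξ*u - dd κ ξ ρ u ≠ critLevel κ t := by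
    have hρ0 : 0 < ρ := hρp.trans hρ
    obtain ⟨hc, hQ⟩ := outer hρ0.ne' (mul_pos (by linarith) (by linarith))
    have hiff := radicand_sub_sq_pos_iff hκ hξ ht hQ
    have hcs := (hiff _).1 hQ
    have hcp := (radicand_pos_iff hξ h1 h2 _).1 hc
    have hlt : uminus κ ξ ρ < u := by
      by_contra! h
      have h3 := (hiff (uminus κ ξ ρ)).2 ⟨by linarith, by linarith [hcs.2, hcp.1]⟩
      have h4 : radicand κ ξ ρ (uminus κ ξ ρ) = 0 := by
        rw [radicand_eq_factored hξ h1 h2]; ring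
      nlinarith [sq_nonneg (κ - ρ*ξ*uminus κ ξ ρ - critLevel κ t)]
    have hf := (radicand_pos_iff hξ h1 h2 u).2 ⟨hlt, hu2 hlt⟩
    refine ⟨hf, fun h => ?_⟩
    obtain ⟨hl, hz⟩ := level hf h
    obtain ⟨hru, s, hs0, hs1, hs⟩ := critPoint_eq_mul hκ hξ ht hl
    have hu0 : u < 0 := (pos_iff_neg_of_mul_neg hru).1 hρ0
    have h3 := (hiff u).2 ⟨hu1, by nlinarith [hcs.2]⟩
    linarith
  rcases hD with ⟨hR, rfl⟩ | ⟨hR, rfl⟩ | ⟨hR, rfl⟩ | ⟨hR, rfl⟩ | ⟨hR, rfl⟩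
  · rw [D1, interior_Icc] at hu
    have hf := (radicand_pos_iff hξ h1 h2 u).2 hu
    exact ⟨hf, inner hf hR.1 (hR.2.trans (min_le_left _ _))⟩
  · rw [D2, interior_Ico] at hu
    have hρ0 : ρ < 0 := hR.2.trans hρm
    obtain ⟨hc, hQ⟩ := outer hρ0.ne
      (mul_pos_of_neg_of_neg (by linarith [hR.2]) (by linarith))
    have hiff := radicand_sub_sq_pos_iff hκ hξ ht hQ
    have hcs := (hiff _).1 hQ
    have hcp := (radicand_pos_iff hξ h1 h2 _).1 hc
    have hlt : u < uplus κ ξ ρ := by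
      by_contra! h
      have h3 := (hiff (uplus κ ξ ρ)).2 ⟨by linarith [hcs.1, hcp.2], by linarith [hu.2]⟩
      have h4 : radicand κ ξ ρ (uplus κ ξ ρ) = 0 := by
        rw [radicand_eq_factored hξ h1 h2]; ring
      nlinarith [sq_nonneg (κ - ρ*ξ*uplus κ ξ ρ - critLevel κ t)]
    have hf := (radicand_pos_iff hξ h1 h2 u).2 ⟨hu.1, hlt⟩
    refine ⟨hf, fun h => ?_⟩
    obtain ⟨hl, hz⟩ := level hf h
    obtain ⟨hru, s, hs0, hs1, hs⟩ := critPoint_eq_mul hκ hξ ht hl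
    have hu0 : 0 < u := (neg_iff_pos_of_mul_neg hru).1 hρ0
    have h3 := (hiff u).2 ⟨by nlinarith [hcs.1], hu.2⟩
    linarith
  · rw [D3a, interior_Ioc] at hu
    exact upper hR.1 hu.1 fun _ => hu.2
  · rw [D3b, interior_Ioc] at hu
    exact upper hR.1 hu.1 fun h => lt_uplus_of_lt_one hξ h1 h2 h hu.2
  · rw [D4, interior_Ioc] at hu
    have hf := (radicand_pos_iff hξ h1 h2 u).2 ⟨hu.1, lt_uplus_of_lt_one hξ h1 h2 hu.1 hu.2⟩
    have hκξ : 0 < κ/ξ := div_pos hκ hξ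
    exact ⟨hf, inner hf (by linarith [hR.1]) (hR.2.trans (min_le_left _ _))⟩

lemma exists_abs_le_mul_exp_neg {F : ℝ → ℝ} (hF : DifferentiableAt ℝ F 0) (hF0 : F 0 = 0)
    {d : ℝ} (hd : 0 < d) :
    ∃ C > 0, ∃ τ₀ > 0, ∀ τ > τ₀, |F (Real.exp (-(d*τ)))| ≤ C * Real.exp (-(d*τ)) := by
  obtain ⟨C, hC, hbound⟩ := hF.isBigO_sub.exists_pos
  have hlim : Tendsto (fun τ : ℝ => Real.exp (-(d*τ))) atTop (nhds 0) :=
    Real.tendsto_exp_neg_atTop_nhds_zero.comp (tendsto_id.const_mul_atTop hd)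
  obtain ⟨T, hT⟩ := eventually_atTop.1 (hlim.eventually hbound.bound)
  refine ⟨C, hC, max T 1, by positivity, fun τ hτ => ?_⟩
  have := hT τ ((le_max_left _ _).trans hτ.le)
  simpa [hF0] using this

theorem stmt7 (κ θ ξ ρ v t : ℝ) (hκ : 0 < κ) (hθ : 0 < θ) (hξ : 0 < ξ) (hv : 0 < v)
    (hρ₁ : -1 < ρ) (hρ₂ : ρ < 1) (ht : 0 < t)
    (D : Set ℝ) (hD : regimeD κ ξ ρ t D)
    (u : ℝ) (hu : u ∈ interior D) (hu1 : u ≠ 1) :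
    0 < dd κ ξ ρ u ∧
    ∃ C > 0, ∃ τ₀ > 0, ∀ τ > τ₀,
      |Lam κ θ ξ ρ v t τ u - VV κ θ ξ ρ u - HH κ θ ξ ρ v t u / τ|
        ≤ C * Real.exp (-(dd κ ξ ρ u * τ)) / τ := by
  obtain ⟨hf, hcrit⟩ := radicand_pos_and_ne_critLevel hκ hξ hρ₁ hρ₂ ht hD hu
  have hd : 0 < dd κ ξ ρ u := Real.sqrt_pos.2 hf
  have hd2 : dd κ ξ ρ u ^ 2 = (κ - ρ*ξ*u)^2 + u*(1-u)*ξ^2 := Real.sq_sqrt hf.le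
  refine ⟨hd, ?_⟩
  have hE := exp_mul_sub_one_pos hκ ht
  have hE0 := Real.exp_pos (κ*t)
  have hsum : κ - ρ*ξ*u + dd κ ξ ρ u ≠ 0 := by
    intro h
    have h0 : u*(1-u)*ξ^2 = 0 := by
      linear_combination hd2 * (-1) + (dd κ ξ ρ u - (κ - ρ*ξ*u)) * h
    have hu0 : u = 0 := by
      by_contra hne
      have : 1 - u ≠ 0 := sub_ne_zero.2 (Ne.symm hu1)
      exact (by positivity : u*(1-u)*ξ^2 ≠ 0) h0
    rw [hu0] at h hd
    linarith
  have hg : 1 - gam κ ξ ρ u ≠ 0 := by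
    have : 1 - gam κ ξ ρ u = 2*dd κ ξ ρ u / (κ - ρ*ξ*u + dd κ ξ ρ u) := by
      unfold gam; field_simp; ring
    rw [this]
    exact div_ne_zero (by positivity) hsum
  have hq : 1 - 2*bet κ ξ t*((κ - ρ*ξ*u - dd κ ξ ρ u)/ξ^2) ≠ 0 := by
    intro h
    apply hcrit
    rw [critLevel, eq_div_iff hE.ne']
    rw [bet, Real.exp_neg] at h
    field_simp at h
    linarith
  set b := (κ - ρ*ξ*u - dd κ ξ ρ u)/ξ^2 with hb
  have hV : VV κ θ ξ ρ u = κ*θ*b := by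
    rw [VV, mu, hb]; field_simp
  set g := gam κ ξ ρ u with hgdef
  set β := bet κ ξ t with hβ
  set M := mu κ θ ξ with hM
  set w := v * Real.exp (-(κ*t)) with hw
  let F : ℝ → ℝ := fun x =>
    -(M * Real.log ((1 - g*x)/(1-g))) + b*(1-x)/(1-g*x) * w / (1 - 2*β*(b*(1-x)/(1-g*x)))
      - M * Real.log (1 - 2*β*(b*(1-x)/(1-g*x)))
      - b*w/(1 - 2*β*b) + M * Real.log ((1 - 2*β*b)/(1-g))
  have hF0 : F 0 = 0 := by
    simp only [F, mul_zero, sub_zero, mul_one, div_one]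
    rw [Real.log_div hq hg, Real.log_div one_ne_zero hg, Real.log_one]
    ring
  have hgx : (1 : ℝ) - g*0 ≠ 0 := by simp
  have hqx : 1 - 2*β*(b*(1-0)/(1-g*0)) ≠ 0 := by simpa using hq
  have hlx : (1 - g*0)/(1-g) ≠ 0 := div_ne_zero hgx hg
  have hF : DifferentiableAt ℝ F 0 := by
    fun_prop (disch := assumption)
  obtain ⟨C, hC, τ₀, hτ₀, hbound⟩ := exists_abs_le_mul_exp_neg hF hF0 hd
  refine ⟨C, hC, τ₀, hτ₀, fun τ hτ => ?_⟩
  have hτ0 : 0 < τ := hτ₀.trans hτ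
  have hHH : HH κ θ ξ ρ v t u = b*w/(1 - 2*β*b) - M * Real.log ((1 - 2*β*b)/(1-g)) := by
    rw [HH, hV, ← hgdef, ← hβ, ← hM]
    have hfac : κ*θ - 2*β*(κ*θ*b) = κ*θ*(1 - 2*β*b) := by ring
    have hκθ : κ*θ ≠ 0 := by positivity
    rw [hfac, mul_div_mul_left _ _ hκθ, hw]
    congr 1
    rw [show κ*θ*b*v*Real.exp (-(κ*t)) = κ*θ*(b*(v*Real.exp (-(κ*t)))) by ring,
      mul_div_mul_left _ _ hκθ]
  have hid : Lam κ θ ξ ρ v t τ u - VV κ θ ξ ρ u - HH κ θ ξ ρ v t u / τ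
      = F (Real.exp (-(dd κ ξ ρ u * τ))) / τ := by
    rw [hHH, Lam, AA, BB, VV, ← hgdef, ← hβ, ← hM, ← hb, mul_assoc _ v, ← hw]
    simp only [F]
    field_simp
    ring
  rw [hid, abs_div, abs_of_pos hτ0]
  gcongr
  exact hbound τ hτ

end Heston
end
end

section
/- Assume ρ > κ/ξ (regimes R3b or R4) and let k ≥ V'(1). Suppose (u*_τ(k))_{τ>τ₁} solves V'(u*_τ(k)) + H'(u*_τ(k))/τ = k with u*_τ(k) in the interior of D∞ and u*_τ(k) → 1 as τ → ∞. Then: (a) if k > V'(1), u*_τ(k) = 1 − μ/((k−V'(1))τ) + O(τ^{−2}) as τ → ∞; (b) if k = V'(1), u*_τ(k) = 1 − sqrt(μ/V''(1))·τ^{−1/2} + O(τ^{−1}) as τ → ∞. -/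
open Real Set Filter Asymptotics

noncomputable section

namespace Heston

theorem analyticAt_sqrt {x : ℝ} (hx : x ≠ 0) : AnalyticAt ℝ Real.sqrt x :=
  (Real.contDiffAt_sqrt hx).analyticAt

/-- First-order Taylor expansion with quadratic remainder for an analytic function. -/
theorem _root_.AnalyticAt.eventually_abs_taylor_le {f : ℝ → ℝ} {a : ℝ} (hf : AnalyticAt ℝ f a) :
    ∃ C, 0 < C ∧ ∀ᶠ x in nhds a, |f x - f a - deriv f a * (x - a)| ≤ C * (x - a) ^ 2 := by
  obtain ⟨p, hp⟩ := hf
  have h₁ := hp.has_fpower_series_dslope_fslope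
  have hg : DifferentiableAt ℝ (dslope f a) a := h₁.analyticAt.differentiableAt
  obtain ⟨C, hC, hb⟩ := hg.isBigO_sub.exists_pos
  refine ⟨C, hC, ?_⟩
  filter_upwards [hb.bound] with x hx
  rw [dslope_same, Real.norm_eq_abs, Real.norm_eq_abs] at hx
  have h₂ : f x - f a - deriv f a * (x - a) = (x - a) * (dslope f a x - deriv f a) := by
    have := sub_smul_dslope f a x
    rw [smul_eq_mul] at this
    linarith
  rw [h₂, abs_mul, ← sq_abs (x - a)]
  nlinarith [abs_nonneg (x - a)]

theorem _root_.AnalyticAt.eventually_abs_le {f : ℝ → ℝ} {a : ℝ} (hf : AnalyticAt ℝ f a) :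
    ∃ C, 0 < C ∧ ∀ᶠ x in nhds a, |f x| ≤ C := by
  refine ⟨|f a| + 1, by positivity, ?_⟩
  have := hf.continuousAt.abs.tendsto.eventually (gt_mem_nhds (lt_add_one |f a|))
  filter_upwards [this] with x hx using le_of_lt hx

section Perturbation

variable {w : ℝ → ℝ} {m b C δ : ℝ}

theorem isBigO_of_perturbed_linear (hm : 0 < m) (hb : 0 < b) (hC : 0 < C) (hδ : 0 < δ)
    (hw : Tendsto w atTop (nhds 0)) (hpos : ∀ᶠ τ in atTop, 0 < w τ)
    (h : ∀ᶠ τ in atTop, |δ * w τ * τ - m + b * w τ ^ 2 * τ| ≤ C * w τ ^ 3 * τ + C * w τ) :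
    (fun τ : ℝ => w τ - m / (δ * τ)) =O[atTop] fun τ : ℝ => τ ^ (-(2:ℝ)) := by
  set K := (m + C) / δ with hK
  refine IsBigO.of_bound ((b * K ^ 2 + C * K ^ 2 + C * K) / δ) ?_
  have hsmall : ∀ᶠ τ in atTop, w τ < min 1 (b / C) :=
    hw.eventually (gt_mem_nhds (by positivity))
  filter_upwards [hpos, h, hsmall, eventually_gt_atTop 0] with τ h0 h1 h2 hτ
  have hw1 : w τ < 1 := h2.trans_le (min_le_left _ _)
  have hwb : C * w τ < b := by
    have := h2.trans_le (min_le_right _ _)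
    rw [lt_div_iff₀ hC] at this
    linarith
  have hwK : w τ * τ ≤ K := by
    rw [hK, le_div_iff₀ hδ]
    have h3 := (abs_le.mp h1).2
    have h4 : C * w τ ^ 3 * τ ≤ b * w τ ^ 2 * τ := by
      have : 0 ≤ w τ ^ 2 * τ := by positivity
      nlinarith
    nlinarith
  have hw0 : w τ ≤ K / τ := by rwa [le_div_iff₀ hτ]
  have hKpos : 0 < K := by positivity
  have hsq : w τ ^ 2 * τ ≤ K ^ 2 / τ := by
    rw [le_div_iff₀ hτ]
    calc w τ ^ 2 * τ * τ = (w τ * τ) ^ 2 := by ring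
      _ ≤ K ^ 2 := by gcongr
  have hcu : w τ ^ 3 * τ ≤ K ^ 2 / τ := by
    refine le_trans ?_ hsq
    have : 0 ≤ w τ ^ 2 * τ := by positivity
    nlinarith
  have hmain : |δ * w τ * τ - m| ≤ (b * K ^ 2 + C * K ^ 2 + C * K) / τ := by
    have e : (b * K ^ 2 + C * K ^ 2 + C * K) / τ
        = b * (K ^ 2 / τ) + C * (K ^ 2 / τ) + C * (K / τ) := by ring
    rw [e]
    have h5 : 0 ≤ b * w τ ^ 2 * τ := by positivity
    have h6 := mul_le_mul_of_nonneg_left hsq hb.le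
    have h7 := mul_le_mul_of_nonneg_left hcu hC.le
    have h8 := mul_le_mul_of_nonneg_left hw0 hC.le
    have h9 := abs_le.mp h1
    rw [abs_le]
    constructor <;> nlinarith [h9.1, h9.2]
  have e1 : w τ - m / (δ * τ) = (δ * w τ * τ - m) / (δ * τ) := by field_simp
  have e2 : τ ^ (-(2:ℝ)) = 1 / τ ^ 2 := by
    rw [Real.rpow_neg hτ.le, one_div]; norm_cast
  rw [e1, e2, Real.norm_eq_abs, Real.norm_eq_abs, abs_div, abs_of_pos (by positivity : 0 < δ * τ),
    abs_of_pos (by positivity : 0 < 1 / τ ^ 2), div_le_iff₀ (by positivity)]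
  refine hmain.trans (le_of_eq ?_)
  field_simp

theorem isBigO_of_perturbed_quadratic (hm : 0 < m) (hb : 0 < b) (hC : 0 < C)
    (hw : Tendsto w atTop (nhds 0)) (hpos : ∀ᶠ τ in atTop, 0 < w τ)
    (h : ∀ᶠ τ in atTop, |b * w τ ^ 2 * τ - m| ≤ C * w τ ^ 3 * τ + C * w τ) :
    (fun τ : ℝ => w τ - √(m / b) * τ ^ (-(1:ℝ) / 2)) =O[atTop] fun τ : ℝ => τ ^ (-(1:ℝ)) := by
  set K := 2 * (m + C) / b with hK
  set s := √(m / b) with hs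
  have hs0 : 0 < s := by positivity
  have hKpos : 0 < K := by positivity
  refine IsBigO.of_bound (C * (K + 1) / b * √K / s) ?_
  have hsmall : ∀ᶠ τ in atTop, w τ < min 1 (b / (2 * C)) :=
    hw.eventually (gt_mem_nhds (by positivity))
  filter_upwards [hpos, h, hsmall, eventually_gt_atTop 0] with τ h0 h1 h2 hτ
  have hw1 : w τ < 1 := h2.trans_le (min_le_left _ _)
  have hwb : 2 * C * w τ < b := by
    have := h2.trans_le (min_le_right _ _)
    rw [lt_div_iff₀ (by positivity)] at this
    linarith
  have hq0 : 0 ≤ w τ ^ 2 * τ := by positivity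
  have hwK : w τ ^ 2 * τ ≤ K := by
    rw [hK, le_div_iff₀ hb]
    have h3 := (abs_le.mp h1).2
    have h4 : 2 * C * w τ ^ 3 * τ ≤ b * w τ ^ 2 * τ := by nlinarith
    nlinarith
  have hτs : √τ ^ 2 = τ := Real.sq_sqrt hτ.le
  have hτ0 : 0 < √τ := Real.sqrt_pos.mpr hτ
  have hr : w τ * √τ ≤ √K := by
    apply Real.le_sqrt_of_sq_le
    rw [mul_pow, hτs]
    exact hwK
  have hs2 : s ^ 2 = m / b := Real.sq_sqrt (by positivity)
  have hdiff : |(w τ * √τ) ^ 2 - s ^ 2| ≤ C * (K + 1) / b * w τ := by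
    have e : (w τ * √τ) ^ 2 - s ^ 2 = (b * w τ ^ 2 * τ - m) / b := by
      rw [mul_pow, hτs, hs2]; field_simp
    rw [e, abs_div, abs_of_pos hb, div_le_iff₀ hb]
    refine h1.trans ?_
    have e2 : C * (K + 1) / b * w τ * b = C * K * w τ + C * w τ := by field_simp
    rw [e2]
    have : C * w τ * (w τ ^ 2 * τ) ≤ C * w τ * K := by gcongr
    linarith
  have hdiff2 : |w τ * √τ - s| * s ≤ C * (K + 1) / b * w τ := by
    refine le_trans ?_ hdiff
    rw [sq_sub_sq, abs_mul, mul_comm, abs_of_pos (by positivity : 0 < w τ * √τ + s)]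
    gcongr
    have : 0 < w τ * √τ := by positivity
    linarith
  have e2 : τ ^ (-(1:ℝ) / 2) = 1 / √τ := by
    rw [neg_div, Real.rpow_neg hτ.le, ← Real.sqrt_eq_rpow, one_div]
  have e3 : τ ^ (-(1:ℝ)) = 1 / (√τ * √τ) := by
    rw [Real.rpow_neg_one, one_div, ← sq, hτs]
  have e4 : w τ - s * (1 / √τ) = (w τ * √τ - s) / √τ := by field_simp
  rw [e2, e3, e4, Real.norm_eq_abs, Real.norm_eq_abs, abs_div, abs_of_pos hτ0,
    abs_of_pos (by positivity : 0 < 1 / (√τ * √τ)), div_le_iff₀ hτ0]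
  have e5 : C * (K + 1) / b * √K / s * (1 / (√τ * √τ)) * √τ
      = C * (K + 1) / b * (√K / √τ) / s := by field_simp
  rw [e5, le_div_iff₀ hs0]
  refine hdiff2.trans ?_
  gcongr
  rwa [le_div_iff₀ hτ0]

/-- If `f(1 - w) + (g(1 - w) + m / w) / τ = k`, then `w` satisfies a perturbed quadratic
equation. -/
theorem exists_perturbed_equation {f g u : ℝ → ℝ} {k : ℝ} (hf : AnalyticAt ℝ f 1)
    (hg : AnalyticAt ℝ g 1) (hu : Tendsto u atTop (nhds 1)) (hlt : ∀ᶠ τ in atTop, u τ < 1)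
    (h : ∀ᶠ τ in atTop, f (u τ) + (g (u τ) + m / (1 - u τ)) / τ = k) :
    ∃ C, 0 < C ∧ ∀ᶠ τ in atTop,
      |(k - f 1) * (1 - u τ) * τ - m + deriv f 1 * (1 - u τ) ^ 2 * τ|
        ≤ C * (1 - u τ) ^ 3 * τ + C * (1 - u τ) := by
  obtain ⟨A, hA, hA'⟩ := hf.eventually_abs_taylor_le
  obtain ⟨B, hB, hB'⟩ := hg.eventually_abs_le
  refine ⟨A + B, by positivity, ?_⟩
  filter_upwards [hlt, h, hu.eventually hA', hu.eventually hB', eventually_gt_atTop 0]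
    with τ h1 h2 h3 h4 hτ
  have hw : 0 < 1 - u τ := by linarith
  have e : (k - f 1) * (1 - u τ) * τ - m + deriv f 1 * (1 - u τ) ^ 2 * τ
      = (f (u τ) - f 1 - deriv f 1 * (u τ - 1)) * ((1 - u τ) * τ) + g (u τ) * (1 - u τ) := by
    rw [← h2]
    field_simp
    ring
  rw [e]
  refine (abs_add_le _ _).trans ?_
  rw [abs_mul, abs_mul (g _), abs_of_pos hw, abs_of_pos (by positivity : 0 < (1 - u τ) * τ)]
  have h5 := mul_le_mul_of_nonneg_right h3 (by positivity : 0 ≤ (1 - u τ) * τ)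
  have h6 := mul_le_mul_of_nonneg_right h4 hw.le
  have h7 : 0 ≤ B * (1 - u τ) ^ 3 * τ := by positivity
  have h8 : 0 ≤ A * (1 - u τ) := by positivity
  nlinarith

end Perturbation

section Regularity

variable {κ θ ξ ρ v t : ℝ}

theorem mu_pos (hκ : 0 < κ) (hθ : 0 < θ) (hξ : 0 < ξ) : 0 < mu κ θ ξ := by
  unfold mu; positivity

theorem dd_one (h : κ < ρ * ξ) : dd κ ξ ρ 1 = ρ * ξ - κ := by
  unfold dd
  rw [show (κ - ρ * ξ * 1) ^ 2 + 1 * (1 - 1) * ξ ^ 2 = (ρ * ξ - κ) ^ 2 by ring]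
  exact Real.sqrt_sq (by linarith)

theorem analyticAt_dd (h : κ < ρ * ξ) : AnalyticAt ℝ (dd κ ξ ρ) 1 := by
  have hq : (κ - ρ * ξ * 1) ^ 2 + 1 * (1 - 1) * ξ ^ 2 ≠ 0 := by
    have : κ - ρ * ξ ≠ 0 := by linarith
    simpa using this
  have hp : AnalyticAt ℝ (fun u : ℝ => (κ - ρ * ξ * u) ^ 2 + u * (1 - u) * ξ ^ 2) 1 := by
    fun_prop
  exact AnalyticAt.comp_of_eq (g := Real.sqrt) (analyticAt_sqrt hq) hp rfl

theorem analyticAt_VV (h : κ < ρ * ξ) : AnalyticAt ℝ (VV κ θ ξ ρ) 1 := by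
  have := analyticAt_dd h
  unfold VV
  fun_prop

theorem VV_one_neg (hκ : 0 < κ) (hθ : 0 < θ) (hξ : 0 < ξ) (h : κ < ρ * ξ) :
    VV κ θ ξ ρ 1 < 0 := by
  have := mu_pos hκ hθ hξ
  unfold VV
  rw [dd_one h]
  apply mul_neg_of_pos_of_neg <;> linarith

/-- The strict convexity of `V` at `1`. -/
theorem deriv_deriv_VV_one_pos (hκ : 0 < κ) (hθ : 0 < θ) (hξ : 0 < ξ) (hρ₁ : -1 < ρ)
    (hρ₂ : ρ < 1) (h : κ < ρ * ξ) : 0 < deriv (deriv (VV κ θ ξ ρ)) 1 := by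
  have hmu := mu_pos hκ hθ hξ
  set q : ℝ → ℝ := fun u => (κ - ρ * ξ * u) ^ 2 + u * (1 - u) * ξ ^ 2 with hq
  set q' : ℝ → ℝ := fun u => -(2 * ρ * ξ * (κ - ρ * ξ * u)) + (1 - 2 * u) * ξ ^ 2 with hq'
  have hqd : ∀ u, HasDerivAt q (q' u) u := fun u => by
    have h1 := (((hasDerivAt_id u).const_mul (ρ * ξ)).const_sub κ).pow 2
    have h2 := ((hasDerivAt_id u).mul ((hasDerivAt_id u).const_sub 1)).mul_const (ξ ^ 2)
    refine (h1.add h2).congr_deriv ?_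
    simp [hq']
    ring
  have hqd' : ∀ u, HasDerivAt q' (2 * ρ ^ 2 * ξ ^ 2 - 2 * ξ ^ 2) u := fun u => by
    have h1 := ((((hasDerivAt_id u).const_mul (ρ * ξ)).const_sub κ).const_mul (2 * ρ * ξ)).neg
    have h2 := (((hasDerivAt_id u).const_mul 2).const_sub 1).mul_const (ξ ^ 2)
    refine (h1.add h2).congr_deriv ?_
    ring
  have hq1 : q 1 = (ρ * ξ - κ) ^ 2 := by simp [hq]; ring
  have ha : 0 < ρ * ξ - κ := by linarith
  have hsq1 : √(q 1) = ρ * ξ - κ := by rw [hq1]; exact Real.sqrt_sq ha.le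
  have hpos : ∀ᶠ u in nhds (1:ℝ), 0 < q u :=
    (hqd 1).continuousAt.eventually (lt_mem_nhds (by rw [hq1]; positivity))
  have hdV : deriv (VV κ θ ξ ρ) =ᶠ[nhds 1]
      fun u => mu κ θ ξ / 2 * (-(ρ * ξ) - q' u / (2 * √(q u))) := by
    filter_upwards [hpos] with u hu
    have h1 := (((hasDerivAt_id u).const_mul (ρ * ξ)).const_sub κ).sub
      ((hqd u).sqrt hu.ne')
    have h2 := h1.const_mul (mu κ θ ξ / 2)
    rw [mul_one] at h2
    exact h2.deriv
  rw [hdV.deriv_eq]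
  have hs := ((hqd 1).sqrt (by rw [hq1]; positivity)).const_mul 2
  have h3 := (((hqd' 1).div hs (by rw [hsq1]; positivity)).const_sub (-(ρ * ξ))).const_mul
    (mu κ θ ξ / 2)
  have h4 := h3.deriv
  simp only [Pi.div_apply] at h4
  rw [h4, hsq1]
  apply mul_pos (by positivity)
  rw [neg_pos]
  apply div_neg_of_neg_of_pos _ (by positivity)
  have e : (2 * ρ ^ 2 * ξ ^ 2 - 2 * ξ ^ 2) * (2 * (ρ * ξ - κ))
      - q' 1 * (2 * (q' 1 / (2 * (ρ * ξ - κ))))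
      = -((4 * κ ^ 2 * ξ ^ 2 * (1 - ρ ^ 2) + (ξ ^ 2 - 2 * κ * ρ * ξ) ^ 2) / (ρ * ξ - κ)) := by
    simp only [hq']
    field_simp
    ring
  rw [e, neg_lt_zero]
  have : 0 < 1 - ρ ^ 2 := by nlinarith
  positivity

/-- The part of `H` which is regular at `1`, obtained by removing `-μ log (1 - u)`. -/
def HHreg (κ θ ξ ρ v t u : ℝ) : ℝ :=
  VV κ θ ξ ρ u * v * Real.exp (-(κ*t)) / (κ*θ - 2 * bet κ ξ t * VV κ θ ξ ρ u)
  - mu κ θ ξ * Real.log ((κ*θ - 2 * bet κ ξ t * VV κ θ ξ ρ u) *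
      (u * ξ ^ 2 / ((dd κ ξ ρ u - (κ - ρ*ξ*u)) * (2 * (κ * θ) * dd κ ξ ρ u))))

theorem denominator_pos (hκ : 0 < κ) (hθ : 0 < θ) (hξ : 0 < ξ) (ht : 0 < t) (h : κ < ρ * ξ) :
    0 < κ * θ - 2 * bet κ ξ t * VV κ θ ξ ρ 1 := by
  have hV := VV_one_neg hκ hθ hξ h
  have hb : 0 < bet κ ξ t := by
    have : Real.exp (-(κ * t)) < 1 := by
      rw [Real.exp_lt_one_iff]
      nlinarith
    unfold bet
    have : 0 < 1 - Real.exp (-(κ * t)) := by linarith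
    positivity
  have := mul_neg_of_pos_of_neg hb hV
  have : 0 < κ * θ := by positivity
  linarith

theorem analyticAt_HHreg (hκ : 0 < κ) (hθ : 0 < θ) (hξ : 0 < ξ) (ht : 0 < t) (h : κ < ρ * ξ) :
    AnalyticAt ℝ (HHreg κ θ ξ ρ v t) 1 := by
  have hd := analyticAt_dd h
  have hV := analyticAt_VV (θ := θ) h
  have hE := denominator_pos hκ hθ hξ ht h
  have hE' : AnalyticAt ℝ (fun u => κ * θ - 2 * bet κ ξ t * VV κ θ ξ ρ u) 1 := by fun_prop
  have ha : 0 < ρ * ξ - κ := by linarith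
  have hp : 0 < (dd κ ξ ρ 1 - (κ - ρ*ξ*1)) * (2 * (κ * θ) * dd κ ξ ρ 1) := by
    rw [dd_one h, show ρ * ξ - κ - (κ - ρ * ξ * 1) = 2 * (ρ * ξ - κ) by ring]
    positivity
  have hp' : AnalyticAt ℝ (fun u => (dd κ ξ ρ u - (κ - ρ*ξ*u)) * (2 * (κ * θ) * dd κ ξ ρ u)) 1 := by
    fun_prop
  have hn : AnalyticAt ℝ (fun u : ℝ => u * ξ ^ 2) 1 := by fun_prop
  have hn' : AnalyticAt ℝ (fun u => VV κ θ ξ ρ u * v * Real.exp (-(κ*t))) 1 := by fun_prop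
  refine (hn'.fun_div hE' hE.ne').fun_sub (analyticAt_const.fun_mul
    ((hE'.fun_mul (hn.fun_div hp' hp.ne')).log ?_))
  positivity

theorem HH_eq_HHreg_sub_log (hκ : 0 < κ) (hθ : 0 < θ) (hξ : 0 < ξ) (ht : 0 < t)
    (h : κ < ρ * ξ) : ∀ᶠ u in nhds (1:ℝ), u < 1 →
      HH κ θ ξ ρ v t u = HHreg κ θ ξ ρ v t u - mu κ θ ξ * Real.log (1 - u) := by
  have hd := (analyticAt_dd h).continuousAt
  have hV := (analyticAt_VV (θ := θ) h).continuousAt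
  have ha : 0 < ρ * ξ - κ := by linarith
  have hE : ∀ᶠ u in nhds (1:ℝ), 0 < κ * θ - 2 * bet κ ξ t * VV κ θ ξ ρ u :=
    (continuousAt_const.sub (continuousAt_const.mul hV)).eventually
      (lt_mem_nhds (denominator_pos hκ hθ hξ ht h))
  have hd0 : ∀ᶠ u in nhds (1:ℝ), 0 < dd κ ξ ρ u :=
    hd.eventually (lt_mem_nhds (by rw [dd_one h]; exact ha))
  have hn0 : ∀ᶠ u in nhds (1:ℝ), κ - ρ * ξ * u < 0 := by
    have : ContinuousAt (fun u : ℝ => κ - ρ * ξ * u) 1 := by fun_prop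
    exact this.eventually (gt_mem_nhds (by linarith))
  filter_upwards [hE, hd0, hn0, lt_mem_nhds (zero_lt_one' ℝ)] with u hE hd0 hn0 hu0 hu1
  have hw : 0 < 1 - u := by linarith
  have hdn : 0 < dd κ ξ ρ u - (κ - ρ*ξ*u) := by linarith
  have hsq : dd κ ξ ρ u ^ 2 = (κ - ρ*ξ*u)^2 + u*(1-u)*ξ^2 := by
    unfold dd
    exact Real.sq_sqrt (by positivity)
  have hprod : (κ - ρ*ξ*u + dd κ ξ ρ u) * (dd κ ξ ρ u - (κ - ρ*ξ*u)) = u * (1 - u) * ξ ^ 2 := by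
    linear_combination hsq
  have hsum : 0 < κ - ρ*ξ*u + dd κ ξ ρ u :=
    pos_of_mul_pos_left (by rw [hprod]; positivity) hdn.le
  have hg : 1 - gam κ ξ ρ u = 2 * dd κ ξ ρ u / (κ - ρ*ξ*u + dd κ ξ ρ u) := by
    unfold gam
    field_simp
    ring
  have harg : (κ*θ - 2 * bet κ ξ t * VV κ θ ξ ρ u) / (κ*θ*(1 - gam κ ξ ρ u))
      = (κ*θ - 2 * bet κ ξ t * VV κ θ ξ ρ u) *
      (u * ξ ^ 2 / ((dd κ ξ ρ u - (κ - ρ*ξ*u)) * (2 * (κ * θ) * dd κ ξ ρ u))) * (1 - u) := by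
    have hs : κ - ρ*ξ*u + dd κ ξ ρ u
        = u * (1 - u) * ξ ^ 2 / (dd κ ξ ρ u - (κ - ρ*ξ*u)) := by
      rw [eq_div_iff hdn.ne', hprod]
    rw [hg, hs]
    field_simp
  unfold HH HHreg
  rw [harg, Real.log_mul (by positivity) hw.ne']
  ring

theorem deriv_HH_eq (hκ : 0 < κ) (hθ : 0 < θ) (hξ : 0 < ξ) (ht : 0 < t) (h : κ < ρ * ξ) :
    ∀ᶠ u in nhds (1:ℝ), u < 1 →
      deriv (HH κ θ ξ ρ v t) u = deriv (HHreg κ θ ξ ρ v t) u + mu κ θ ξ / (1 - u) := by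
  filter_upwards [(HH_eq_HHreg_sub_log (v := v) hκ hθ hξ ht h).eventually_nhds,
    (analyticAt_HHreg (v := v) hκ hθ hξ ht h).eventually_analyticAt] with u h1 h2 hu
  have hw : 0 < 1 - u := by linarith
  have heq : HH κ θ ξ ρ v t =ᶠ[nhds u]
      fun x => HHreg κ θ ξ ρ v t x - mu κ θ ξ * Real.log (1 - x) := by
    filter_upwards [h1, gt_mem_nhds hu] with x hx hx1 using hx hx1
  have h3 := h2.differentiableAt.hasDerivAt.sub
    ((((hasDerivAt_id u).const_sub 1).log hw.ne').const_mul (mu κ θ ξ))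
  rw [heq.deriv_eq]
  refine h3.deriv.trans ?_
  simp only [id]
  ring

end Regularity

theorem stmt10 (κ θ ξ ρ v t : ℝ) (hκ : 0 < κ) (hθ : 0 < θ) (hξ : 0 < ξ) (hv : 0 < v)
    (hρ₁ : -1 < ρ) (hρ₂ : ρ < 1) (ht : 0 < t) (hρκ : κ/ξ < ρ)
    (D : Set ℝ)
    (hD : (R3b κ ξ ρ t ∧ D = D3b κ ξ ρ t) ∨ (R4 κ ξ ρ t ∧ D = D4 κ ξ ρ))
    (k : ℝ) (hk : deriv (VV κ θ ξ ρ) 1 ≤ k)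
    (τ₁ : ℝ) (uτ : ℝ → ℝ)
    (huτ : ∀ τ > τ₁, uτ τ ∈ interior D ∧
      deriv (VV κ θ ξ ρ) (uτ τ) + deriv (HH κ θ ξ ρ v t) (uτ τ) / τ = k)
    (hlim : Tendsto uτ atTop (nhds 1)) :
    (deriv (VV κ θ ξ ρ) 1 < k →
      (fun τ : ℝ => uτ τ - (1 - mu κ θ ξ / ((k - deriv (VV κ θ ξ ρ) 1) * τ)))
        =O[atTop] fun τ : ℝ => τ ^ (-(2:ℝ))) ∧
    (k = deriv (VV κ θ ξ ρ) 1 →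
      (fun τ : ℝ => uτ τ -
          (1 - Real.sqrt (mu κ θ ξ / deriv (deriv (VV κ θ ξ ρ)) 1) * τ ^ (-(1:ℝ)/2)))
        =O[atTop] fun τ : ℝ => τ ^ (-(1:ℝ))) := by
  have h : κ < ρ * ξ := (div_lt_iff₀ hξ).mp hρκ
  have hmu := mu_pos hκ hθ hξ
  have hV2 := deriv_deriv_VV_one_pos hκ hθ hξ hρ₁ hρ₂ h
  have hDsub : D ⊆ Iic 1 := by
    rcases hD with ⟨-, rfl⟩ | ⟨-, rfl⟩ <;> exact fun x hx => hx.2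
  have hlt : ∀ᶠ τ in atTop, uτ τ < 1 := by
    filter_upwards [eventually_gt_atTop τ₁] with τ hτ
    have := interior_mono hDsub (huτ τ hτ).1
    rwa [interior_Iic] at this
  have heq : ∀ᶠ τ in atTop, deriv (VV κ θ ξ ρ) (uτ τ)
      + (deriv (HHreg κ θ ξ ρ v t) (uτ τ) + mu κ θ ξ / (1 - uτ τ)) / τ = k := by
    filter_upwards [eventually_gt_atTop τ₁, hlt,
      hlim.eventually (deriv_HH_eq (v := v) hκ hθ hξ ht h)] with τ hτ h1 h2
    rw [← h2 h1]
    exact (huτ τ hτ).2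
  obtain ⟨C, hC, hmain⟩ := exists_perturbed_equation (analyticAt_VV h).deriv
    (analyticAt_HHreg hκ hθ hξ ht h).deriv hlim hlt heq
  have hw : Tendsto (fun τ => 1 - uτ τ) atTop (nhds 0) := by
    simpa using hlim.const_sub 1
  have hpos : ∀ᶠ τ in atTop, 0 < 1 - uτ τ := hlt.mono fun τ hτ => sub_pos.mpr hτ
  constructor
  · intro hk'
    refine (isBigO_of_perturbed_linear hmu hV2 hC (sub_pos.mpr hk') hw hpos hmain).neg_left.congr_left
      fun τ => ?_
    ring
  · intro hk'
    have hmain' : ∀ᶠ τ in atTop,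
        |deriv (deriv (VV κ θ ξ ρ)) 1 * (1 - uτ τ) ^ 2 * τ - mu κ θ ξ|
          ≤ C * (1 - uτ τ) ^ 3 * τ + C * (1 - uτ τ) := by
      filter_upwards [hmain] with τ hτ
      convert hτ using 2
      rw [hk']
      ring
    refine (isBigO_of_perturbed_quadratic hmu hV2 hC hw hpos hmain').neg_left.congr_left
      fun τ => ?_
    ring

end Heston
end
end

section
/- Let c > 0 and q ∈ ℝ \ {0}, and let N denote the standard normal cumulative distribution function. Then: (i) ∫_ℝ e^{−cu²/2}/(−iu−q) du = e^{q²c/2}·π·(2N(q√c) − 1 − sgn(q)); (ii) ∫_ℝ e^{−cu²/2}·(iu)/(−iu−q) du = −sqrt(2π/c) + e^{q²c/2}·π·q·(1 + sgn(q) − 2N(q√c)); (iii) ∫_ℝ e^{−cu²/2}·(iu³)/(−iu−q) du = sqrt(2π)·(q²c−1)/c^{3/2} − 2π·q²·|q|·e^{q²c/2}·N(−|q|√c). -/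
open Real Filter MeasureTheory

noncomputable section

/-- The standard normal cumulative distribution function. -/
def Ncdf (x : ℝ) : ℝ := (Real.sqrt (2*Real.pi))⁻¹ * ∫ y in Set.Iic x, Real.exp (-(y^2/2))

/-- sgn(x) = 1 if x ≥ 0 and −1 otherwise. -/
def sgn (x : ℝ) : ℝ := if 0 ≤ x then 1 else -1

theorem integral_mul_exp_neg_mul_sq_eq_zero {b : ℝ} (hb : 0 < b) :
    ∫ x : ℝ, x * Real.exp (-b * x ^ 2) = 0 := by
  have hderiv (x : ℝ) : HasDerivAt (fun x : ℝ => Real.exp (-b * x ^ 2))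
      (-(2 * b) * (x * Real.exp (-b * x ^ 2))) x := by
    convert ((hasDerivAt_pow 2 x).const_mul (-b)).exp using 1
    push_cast
    ring
  have h := integral_eq_zero_of_hasDerivAt_of_integrable hderiv
    ((integrable_mul_exp_neg_mul_sq hb).const_mul _) (integrable_exp_neg_mul_sq hb)
  rw [integral_const_mul] at h
  simpa [hb.ne'] using h

theorem integrable_sq_mul_exp_neg_mul_sq {b : ℝ} (hb : 0 < b) :
    Integrable fun x : ℝ => x ^ 2 * Real.exp (-b * x ^ 2) := by
  simpa using integrable_rpow_mul_exp_neg_mul_sq hb (s := 2) (by norm_num)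

theorem integral_sq_mul_exp_neg_mul_sq {b : ℝ} (hb : 0 < b) :
    ∫ x : ℝ, x ^ 2 * Real.exp (-b * x ^ 2) = √(π / b) / (2 * b) := by
  have hderiv (x : ℝ) : HasDerivAt (fun x : ℝ => x * Real.exp (-b * x ^ 2))
      (Real.exp (-b * x ^ 2) - 2 * b * (x ^ 2 * Real.exp (-b * x ^ 2))) x := by
    refine ((hasDerivAt_id' x).mul ((hasDerivAt_pow 2 x).const_mul (-b)).exp).congr_deriv ?_
    push_cast
    ring
  have h := integral_eq_zero_of_hasDerivAt_of_integrable hderiv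
    ((integrable_exp_neg_mul_sq hb).sub ((integrable_sq_mul_exp_neg_mul_sq hb).const_mul _))
    (integrable_mul_exp_neg_mul_sq hb)
  rw [integral_sub (integrable_exp_neg_mul_sq hb)
    ((integrable_sq_mul_exp_neg_mul_sq hb).const_mul _), integral_const_mul,
    integral_gaussian] at h
  rw [eq_div_iff (by positivity)]
  linarith

theorem setIntegral_Ioi_comp_add_right (f : ℝ → ℝ) (a b : ℝ) :
    ∫ x in Set.Ioi a, f (x + b) = ∫ x in Set.Ioi (a + b), f x := by
  have h := (measurePreserving_add_right volume b).setIntegral_preimage_emb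
    (measurableEmbedding_addRight b) f (Set.Ioi (a + b))
  simpa using h

theorem integrable_exp_neg_sq_div_two : Integrable fun y : ℝ => Real.exp (-(y ^ 2 / 2)) := by
  convert integrable_exp_neg_mul_sq (b := 1 / 2) (by norm_num) using 3
  ring

theorem Ncdf_add_Ncdf_neg (x : ℝ) : Ncdf x + Ncdf (-x) = 1 := by
  have h1 : ∫ y in Set.Iic (-x), Real.exp (-(y ^ 2 / 2))
      = ∫ y in Set.Ioi x, Real.exp (-(y ^ 2 / 2)) := by
    rw [← integral_comp_neg_Ioi]
    simp
  have h2 : ∫ y : ℝ, Real.exp (-(y ^ 2 / 2)) = √(2 * π) := by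
    convert integral_gaussian (1 / 2) using 4 <;> ring
  have hpos : 0 < √(2 * π) := by positivity
  rw [Ncdf, Ncdf, ← mul_add, h1, intervalIntegral.integral_Iic_add_Ioi
    integrable_exp_neg_sq_div_two.integrableOn integrable_exp_neg_sq_div_two.integrableOn, h2,
    inv_mul_cancel₀ hpos.ne']

theorem integral_Ioi_exp_neg_mul_sub_sq_div {c a : ℝ} (hc : 0 < c) :
    ∫ t in Set.Ioi (0 : ℝ), √(2 * π / c) * Real.exp (-a * t - t ^ 2 / (2 * c))
      = 2 * π * Real.exp (a ^ 2 * c / 2) * Ncdf (-(a * √c)) := by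
  have hs : 0 < √c := Real.sqrt_pos.2 hc
  have hsq : √c ^ 2 = c := Real.sq_sqrt hc.le
  have hp : 0 < √(2 * π) := by positivity
  have hpsq : √(2 * π) ^ 2 = 2 * π := Real.sq_sqrt (by positivity)
  have key (t : ℝ) : √(2 * π / c) * Real.exp (-a * t - t ^ 2 / (2 * c))
      = √(2 * π / c) * Real.exp (a ^ 2 * c / 2)
        * Real.exp (-(((√c)⁻¹ * t + a * √c) ^ 2 / 2)) := by
    rw [mul_assoc, ← Real.exp_add]
    congr 2
    have : ((√c)⁻¹ * t + a * √c) ^ 2 = t ^ 2 / c + 2 * a * t + a ^ 2 * c := by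
      field_simp
      rw [hsq]
      ring
    rw [this]
    field_simp
    ring
  simp_rw [key]
  rw [integral_const_mul,
    integral_comp_mul_left_Ioi (fun s => Real.exp (-((s + a * √c) ^ 2 / 2))) 0 (inv_pos.2 hs),
    mul_zero, setIntegral_Ioi_comp_add_right (fun s => Real.exp (-(s ^ 2 / 2))), zero_add, Ncdf,
    ← integral_comp_neg_Ioi]
  simp only [neg_sq, inv_inv, smul_eq_mul]
  rw [Real.sqrt_div (by positivity)]
  field_simp
  rw [hpsq]

theorem integral_gaussian_div_add_I_mul {c a : ℝ} (hc : 0 < c) (ha : 0 < a) :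
    ∫ u : ℝ, Complex.exp (-((c : ℂ) * (u : ℂ) ^ 2 / 2)) / ((a : ℂ) + Complex.I * u)
      = ((2 * π * Real.exp (a ^ 2 * c / 2) * Ncdf (-(a * √c)) : ℝ) : ℂ) := by
  have hre (u : ℝ) : (-((a : ℂ) + Complex.I * u)).re < 0 := by simpa using ha
  have hlap (u : ℝ) : Complex.exp (-((c : ℂ) * (u : ℂ) ^ 2 / 2)) / ((a : ℂ) + Complex.I * u)
      = ∫ t in Set.Ioi (0 : ℝ), Complex.exp (-((c : ℂ) * (u : ℂ) ^ 2 / 2))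
        * Complex.exp (-((a : ℂ) + Complex.I * u) * t) := by
    rw [integral_const_mul, integral_exp_mul_complex_Ioi (hre u)]
    rw [Complex.ofReal_zero, mul_zero, Complex.exp_zero, neg_div_neg_eq, mul_one_div]
  have hint : Integrable (Function.uncurry fun (u t : ℝ) =>
      Complex.exp (-((c : ℂ) * (u : ℂ) ^ 2 / 2)) * Complex.exp (-((a : ℂ) + Complex.I * u) * t))
      (volume.prod (volume.restrict (Set.Ioi (0 : ℝ)))) := by
    refine ((integrable_exp_neg_mul_sq (b := c / 2) (by positivity)).mul_prod
      (exp_neg_integrableOn_Ioi 0 ha)).mono' ?_ ?_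
    · refine Continuous.aestronglyMeasurable ?_
      unfold Function.uncurry
      fun_prop
    · refine Eventually.of_forall fun z => le_of_eq ?_
      simp only [Function.uncurry, norm_mul, Complex.norm_exp]
      congr 2
      · norm_cast
        ring
      · simp
  have hfourier (t : ℝ) : ∫ u : ℝ, Complex.exp (-((c : ℂ) * (u : ℂ) ^ 2 / 2))
        * Complex.exp (-((a : ℂ) + Complex.I * u) * t)
      = ((√(2 * π / c) * Real.exp (-a * t - t ^ 2 / (2 * c)) : ℝ) : ℂ) := by
    have hsplit (u : ℝ) : Complex.exp (-((c : ℂ) * (u : ℂ) ^ 2 / 2))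
        * Complex.exp (-((a : ℂ) + Complex.I * u) * t)
        = Complex.exp (-a * t) * (Complex.exp (Complex.I * (-t : ℂ) * u)
          * Complex.exp (-((c / 2 : ℝ) : ℂ) * (u : ℂ) ^ 2)) := by
      simp only [← Complex.exp_add]
      congr 1
      push_cast
      ring
    have hroot : ((π : ℂ) / ((c / 2 : ℝ) : ℂ)) ^ (1 / 2 : ℂ) = (√(2 * π / c) : ℝ) := by
      rw [Real.sqrt_eq_rpow, Complex.ofReal_cpow (by positivity)]
      push_cast
      congr 1
      field_simp
    simp_rw [hsplit]
    rw [integral_const_mul, fourierIntegral_gaussian (by simpa using hc), hroot, mul_left_comm,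
      ← Complex.exp_add]
    push_cast
    congr 2
    field_simp
    ring
  simp_rw [hlap]
  rw [integral_integral_swap hint]
  simp_rw [hfourier]
  rw [integral_complex_ofReal, integral_Ioi_exp_neg_mul_sub_sq_div hc]

theorem neg_I_mul_sub_ne_zero {q : ℝ} (hq : q ≠ 0) (u : ℝ) :
    -(Complex.I * (u : ℂ)) - (q : ℂ) ≠ 0 := by
  intro h
  apply hq
  simpa using congrArg Complex.re h

theorem integral_gaussian_div_neg_I_mul_sub {c q : ℝ} (hc : 0 < c) (hq : q ≠ 0) :
    ∫ u : ℝ, Complex.exp (-((c : ℂ) * (u : ℂ) ^ 2 / 2)) / (-(Complex.I * (u : ℂ)) - (q : ℂ))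
      = ((-sgn q * (2 * π * Real.exp (q ^ 2 * c / 2) * Ncdf (-(|q| * √c))) : ℝ) : ℂ) := by
  rcases lt_or_gt_of_ne hq with h | h
  · rw [sgn, if_neg h.not_ge, abs_of_neg h, neg_neg, one_mul]
    rw [← neg_sq q, ← integral_gaussian_div_add_I_mul hc (neg_pos.2 h), ← integral_neg_eq_self]
    congr with u
    push_cast
    ring_nf
  · rw [sgn, if_pos h.le, abs_of_pos h, neg_one_mul, Complex.ofReal_neg,
      ← integral_gaussian_div_add_I_mul hc h, ← integral_neg]
    congr with u
    rw [← neg_add', div_neg, add_comm]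

theorem integrable_gaussian_div_neg_I_mul_sub {c q : ℝ} (hc : 0 < c) (hq : q ≠ 0) :
    Integrable fun u : ℝ =>
      Complex.exp (-((c : ℂ) * (u : ℂ) ^ 2 / 2)) / (-(Complex.I * (u : ℂ)) - (q : ℂ)) := by
  refine ((integrable_exp_neg_mul_sq (b := c / 2) (by positivity)).mul_const |q|⁻¹).mono' ?_ ?_
  · refine Continuous.aestronglyMeasurable (Continuous.div (by fun_prop) (by fun_prop)
      (neg_I_mul_sub_ne_zero hq))
  · refine Eventually.of_forall fun u => ?_
    rw [norm_div, div_eq_mul_inv, Complex.norm_exp]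
    have h1 : (-((c : ℂ) * (u : ℂ) ^ 2 / 2)).re = -(c / 2) * u ^ 2 := by
      norm_cast
      ring
    have h2 : |q| ≤ ‖-(Complex.I * (u : ℂ)) - (q : ℂ)‖ := by
      simpa using Complex.abs_re_le_norm (-(Complex.I * (u : ℂ)) - (q : ℂ))
    rw [h1]
    have := abs_pos.2 hq
    gcongr

theorem sgn_mul_self (x : ℝ) : sgn x * x = |x| := by
  unfold sgn
  split_ifs with h
  · rw [abs_of_nonneg h, one_mul]
  · rw [abs_of_neg (not_le.1 h), neg_one_mul]

theorem two_mul_Ncdf_sub_one_sub_sgn (q s : ℝ) :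
    2 * Ncdf (q * s) - 1 - sgn q = -sgn q * (2 * Ncdf (-(|q| * s))) := by
  unfold sgn
  split_ifs with h
  · rw [abs_of_nonneg h]
    linarith [Ncdf_add_Ncdf_neg (q * s)]
  · rw [abs_of_neg (not_le.1 h)]
    ring_nf

theorem stmt15 (c q : ℝ) (hc : 0 < c) (hq : q ≠ 0) :
    (∫ u : ℝ, Complex.exp (-((c:ℂ)*(u:ℂ)^2/2)) / (-(Complex.I*(u:ℂ)) - (q:ℂ))
      = ((Real.exp (q^2*c/2) * Real.pi * (2*Ncdf (q*Real.sqrt c) - 1 - sgn q) : ℝ) : ℂ)) ∧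
    (∫ u : ℝ, Complex.exp (-((c:ℂ)*(u:ℂ)^2/2)) * (Complex.I*(u:ℂ))
        / (-(Complex.I*(u:ℂ)) - (q:ℂ))
      = ((-Real.sqrt (2*Real.pi/c)
          + Real.exp (q^2*c/2)*Real.pi*q*(1 + sgn q - 2*Ncdf (q*Real.sqrt c)) : ℝ) : ℂ)) ∧
    (∫ u : ℝ, Complex.exp (-((c:ℂ)*(u:ℂ)^2/2)) * (Complex.I*(u:ℂ)^3)
        / (-(Complex.I*(u:ℂ)) - (q:ℂ))
      = ((Real.sqrt (2*Real.pi)*(q^2*c - 1)/c ^ ((3:ℝ)/2)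
          - 2*Real.pi*q^2*(abs q)*Real.exp (q^2*c/2)*Ncdf (-((abs q)*Real.sqrt c)) : ℝ) : ℂ)) := by
  have hb : 0 < c / 2 := by positivity
  have hK := integral_gaussian_div_neg_I_mul_sub hc hq
  have hKint := integrable_gaussian_div_neg_I_mul_sub hc hq
  have hN := two_mul_Ncdf_sub_one_sub_sgn q (√c)
  have hexp (u : ℝ) : Complex.exp (-((c : ℂ) * (u : ℂ) ^ 2 / 2))
      = ((Real.exp (-(c / 2) * u ^ 2) : ℝ) : ℂ) := by
    push_cast
    ring_nf
  have hroot : √(π / (c / 2)) = √(2 * π / c) := by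
    congr 1
    field_simp
  refine ⟨?_, ?_, ?_⟩
  · rw [hK, hN]
    congr 1
    ring
  · have hdecomp (u : ℝ) : Complex.exp (-((c : ℂ) * (u : ℂ) ^ 2 / 2)) * (Complex.I * (u : ℂ))
          / (-(Complex.I * (u : ℂ)) - (q : ℂ))
        = ((-Real.exp (-(c / 2) * u ^ 2) : ℝ) : ℂ)
          - q * (Complex.exp (-((c : ℂ) * (u : ℂ) ^ 2 / 2))
            / (-(Complex.I * (u : ℂ)) - (q : ℂ))) := by
      have hD := neg_I_mul_sub_ne_zero hq u
      rw [Complex.ofReal_neg, ← hexp, div_eq_iff hD]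
      linear_combination
        (q : ℂ) * div_mul_cancel₀ (Complex.exp (-((c : ℂ) * (u : ℂ) ^ 2 / 2))) hD
    have hint0 : Integrable fun u : ℝ => ((-Real.exp (-(c / 2) * u ^ 2) : ℝ) : ℂ) :=
      (integrable_exp_neg_mul_sq hb).neg.ofReal
    simp_rw [hdecomp]
    rw [integral_sub hint0 (hKint.const_mul _),
      integral_const_mul, hK, integral_complex_ofReal, integral_neg, integral_gaussian, hroot]
    norm_cast
    linear_combination (Real.exp (q ^ 2 * c / 2) * π * q) * hN
  · have hdecomp (u : ℝ) : Complex.exp (-((c : ℂ) * (u : ℂ) ^ 2 / 2)) * (Complex.I * (u : ℂ) ^ 3)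
          / (-(Complex.I * (u : ℂ)) - (q : ℂ))
        = ((q ^ 2 * Real.exp (-(c / 2) * u ^ 2)
            - u ^ 2 * Real.exp (-(c / 2) * u ^ 2) : ℝ) : ℂ)
          - q * Complex.I * ((u * Real.exp (-(c / 2) * u ^ 2) : ℝ) : ℂ)
          + (q : ℂ) ^ 3 * (Complex.exp (-((c : ℂ) * (u : ℂ) ^ 2 / 2))
            / (-(Complex.I * (u : ℂ)) - (q : ℂ))) := by
      have hD := neg_I_mul_sub_ne_zero hq u
      simp only [Complex.ofReal_sub, Complex.ofReal_mul, Complex.ofReal_pow, ← hexp]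
      rw [div_eq_iff hD]
      linear_combination
        (-(q : ℂ) ^ 3) * div_mul_cancel₀ (Complex.exp (-((c : ℂ) * (u : ℂ) ^ 2 / 2))) hD
          - q * (u : ℂ) ^ 2 * Complex.exp (-((c : ℂ) * (u : ℂ) ^ 2 / 2)) * Complex.I_sq
    have hint0 := (integrable_exp_neg_mul_sq hb).const_mul (q ^ 2)
    have hint2 := integrable_sq_mul_exp_neg_mul_sq hb
    have hint1 : Integrable fun u : ℝ =>
        q * Complex.I * ((u * Real.exp (-(c / 2) * u ^ 2) : ℝ) : ℂ) :=
      (integrable_mul_exp_neg_mul_sq hb).ofReal.const_mul _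
    have hint02 : Integrable fun u : ℝ => ((q ^ 2 * Real.exp (-(c / 2) * u ^ 2)
        - u ^ 2 * Real.exp (-(c / 2) * u ^ 2) : ℝ) : ℂ) := (hint0.sub hint2).ofReal
    have hint021 : Integrable fun u : ℝ => ((q ^ 2 * Real.exp (-(c / 2) * u ^ 2)
        - u ^ 2 * Real.exp (-(c / 2) * u ^ 2) : ℝ) : ℂ)
        - q * Complex.I * ((u * Real.exp (-(c / 2) * u ^ 2) : ℝ) : ℂ) := hint02.sub hint1
    have hrpow : c ^ ((3 : ℝ) / 2) = c * √c := by
      rw [Real.sqrt_eq_rpow, ← Real.rpow_one_add' hc.le (by norm_num)]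
      norm_num
    simp_rw [hdecomp]
    rw [integral_add hint021 (hKint.const_mul _),
      integral_sub hint02 hint1, integral_const_mul, integral_const_mul, hK,
      integral_complex_ofReal, integral_complex_ofReal, integral_mul_exp_neg_mul_sq_eq_zero hb,
      integral_sub hint0 hint2, integral_const_mul, integral_gaussian,
      integral_sq_mul_exp_neg_mul_sq hb, hroot, hrpow, Real.sqrt_div (by positivity),
      ← sgn_mul_self q]
    norm_cast
    have hs : 0 < √c := Real.sqrt_pos.2 hc
    simp only [mul_zero, sub_zero]
    norm_cast
    field_simp
    ring

end
end
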